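/- arXiv:2510.15008 — 5 statements merged into one kernel-verified Lean document; each statement's English description precedes it below -/
import Mathlib

section
/- ∫_0^{π/2} ln(sin(x)) ln^2(cos(x)) dx = (π/8)ζ(3) − (π/2) ln^3(2). -/
open Real

/-- Riemann zeta value at a positive integer `m > 1`, as the series `∑ 1/n^m`. -/
noncomputable def zetaVal (m : ℕ) : ℝ := ∑' n : ℕ, 1 / (n + 1 : ℝ) ^ m

/-- Polylogarithm `Li_m(z) = ∑_{k≥1} z^k / k^m`. -/
noncomputable def polyLog (m : ℕ) (z : ℝ) : ℝ := ∑' k : ℕ, z ^ (k + 1) / (k + 1 : ℝ) ^ m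

/-- Generalized harmonic number `H_k^{(m)} = ∑_{n=1}^k 1/n^m`. -/
noncomputable def genHarmonic (k m : ℕ) : ℝ := ∑ n ∈ Finset.range k, 1 / (n + 1 : ℝ) ^ m

open MeasureTheory Filter Topology

lemma ls_int_half : IntervalIntegrable (fun x => |Real.log (Real.sin x)| ^ 3) volume 0 (π / 2) := by
  have hg : IntervalIntegrable (fun x : ℝ => 216 * ((2 / π) ^ (-(1/2) : ℝ) * x ^ (-(1/2) : ℝ)))
      volume 0 (π / 2) :=
    ((intervalIntegral.intervalIntegrable_rpow' (by norm_num)).const_mul _).const_mul _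
  refine hg.mono_fun' (Measurable.aestronglyMeasurable (by fun_prop)) ?_
  rw [Set.uIoc_of_le (by positivity)]
  refine (ae_restrict_iff' measurableSet_Ioc).2 (Eventually.of_forall fun x hx => ?_)
  have hx0 := hx.1
  have hp : 0 < 2 / π * x := by positivity
  have h1 := Real.mul_le_sin hx.1.le hx.2
  have hs : 0 < Real.sin x := hp.trans_le h1
  have h2 : |Real.log (Real.sin x)| ≤ |Real.log (2 / π * x)| := by
    rw [abs_of_nonpos (Real.log_nonpos hs.le (Real.sin_le_one x)),
      abs_of_nonpos (Real.log_nonpos hp.le (h1.trans (Real.sin_le_one x)))]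
    exact neg_le_neg (Real.log_le_log hp h1)
  have h3 := Real.abs_log_mul_self_rpow_lt (2 / π * x) (1/6) hp (h1.trans (Real.sin_le_one x)) (by norm_num)
  have hq : 0 < (2 / π * x) ^ (1/6 : ℝ) := Real.rpow_pos_of_pos hp _
  rw [abs_mul, abs_of_pos hq] at h3
  have h4 : |Real.log (2 / π * x)| ≤ 6 * (2 / π * x) ^ (-(1/6) : ℝ) := by
    rw [Real.rpow_neg hp.le, ← div_eq_mul_inv, le_div_iff₀ hq]
    linarith
  beta_reduce
  rw [Real.norm_of_nonneg (by positivity), ← Real.mul_rpow (by positivity) hx0.le]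
  calc |Real.log (Real.sin x)| ^ 3 ≤ (6 * (2 / π * x) ^ (-(1/6) : ℝ)) ^ 3 := by
        gcongr; exact h2.trans h4
    _ = _ := by
        rw [mul_pow, ← Real.rpow_mul_natCast hp.le]; norm_num

lemma lc_int_half : IntervalIntegrable (fun x => |Real.log (Real.cos x)| ^ 3) volume 0 (π / 2) := by
  have := (ls_int_half.comp_sub_left (π / 2) (by simp)).symm
  simpa [Real.sin_pi_div_two_sub] using this

lemma ls_int_pi : IntervalIntegrable (fun x => |Real.log (Real.sin x)| ^ 3) volume 0 π := by
  refine ls_int_half.trans ?_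
  have := (ls_int_half.comp_sub_left π (by simp)).symm
  simpa [Real.sin_pi_sub, show π - π / 2 = π / 2 by ring] using this

lemma ls_int_two : IntervalIntegrable (fun x => |Real.log (Real.sin (x / 2))| ^ 3) volume 0 (2 * π) := by
  have := ls_int_pi.comp_mul_left (c := 1 / 2) (by simp) (by simp)
  convert this using 1
  · ext x; congr 4; ring
  · simp
  · ring

lemma one_sub_exp (θ : ℝ) : 1 - Complex.exp (θ * Complex.I) =
    ((2 * Real.sin (θ / 2) : ℝ) : ℂ) * Complex.exp (((θ - π) / 2 : ℝ) * Complex.I) := by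
  have e1 : Complex.exp (θ * Complex.I) = (Real.cos θ : ℂ) + Real.sin θ * Complex.I := by
    rw [Complex.exp_mul_I]; simp
  have e2 : Complex.exp (((θ - π) / 2 : ℝ) * Complex.I) =
      (Real.sin (θ / 2) : ℂ) - Real.cos (θ/2) * Complex.I := by
    rw [Complex.exp_mul_I, ← Complex.ofReal_cos, ← Complex.ofReal_sin,
      show (θ - π) / 2 = θ / 2 - π / 2 by ring, Real.cos_sub_pi_div_two, Real.sin_sub_pi_div_two]
    push_cast; ring
  rw [e1, e2]
  have c : Real.cos θ = 1 - 2 * Real.sin (θ/2)^2 := by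
    rw [← Real.cos_sq_add_sin_sq (θ/2)] 
    have := Real.cos_two_mul' (θ/2)
    rw [show 2 * (θ/2) = θ by ring] at this
    rw [this]; ring
  have s : Real.sin θ = 2 * Real.sin (θ/2) * Real.cos (θ/2) := by
    rw [← Real.sin_two_mul]; ring_nf
  rw [c, s]
  push_cast
  ring

lemma log_one_sub_exp {θ : ℝ} (h0 : 0 < θ) (h1 : θ < 2 * π) :
    Complex.log (1 - Complex.exp (θ * Complex.I)) =
      (Real.log (2 * Real.sin (θ / 2)) : ℂ) + ((θ - π) / 2 : ℝ) * Complex.I := by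
  have hs : 0 < Real.sin (θ / 2) := Real.sin_pos_of_pos_of_lt_pi (by linarith) (by linarith)
  rw [one_sub_exp, Complex.log_ofReal_mul (by positivity) (Complex.exp_ne_zero _), Complex.log_exp]
  · simp; linarith [Real.pi_pos]
  · simp; linarith [Real.pi_pos]

lemma slit {θ : ℝ} (h0 : 0 < θ) (h1 : θ < 2 * π) :
    1 - Complex.exp (θ * Complex.I) ∈ Complex.slitPlane := by
  have hs : 0 < Real.sin (θ / 2) := Real.sin_pos_of_pos_of_lt_pi (by linarith) (by linarith)
  left
  rw [one_sub_exp, Complex.re_ofReal_mul, Complex.exp_ofReal_mul_I_re]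
  have : 0 < Real.cos ((θ - π) / 2) := Real.cos_pos_of_mem_Ioo ⟨by linarith, by linarith⟩
  positivity

lemma lim_log {θ : ℝ} (h0 : 0 < θ) (h1 : θ < 2 * π) :
    Tendsto (fun r : ℝ => Complex.log (1 - r * Complex.exp (θ * Complex.I))) (𝓝[<] 1)
      (𝓝 ((Real.log (2 * Real.sin (θ / 2)) : ℂ) + ((θ - π) / 2 : ℝ) * Complex.I)) := by
  rw [← log_one_sub_exp h0 h1]
  have : ContinuousAt (fun r : ℝ => Complex.log (1 - r * Complex.exp (θ * Complex.I))) 1 := by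
    apply ContinuousAt.clog (by fun_prop)
    simpa using slit h0 h1
  simpa using this.tendsto.mono_left nhdsWithin_le_nhds

lemma log_norm_bound {θ r : ℝ} (h0 : 0 < θ) (h1 : θ < 2 * π) (hr : 1/4 ≤ r) (hr1 : r < 1) :
    |Real.log ‖1 - r * Complex.exp (θ * Complex.I)‖| ≤ 1 + |Real.log (Real.sin (θ / 2))| := by
  have hs : 0 < Real.sin (θ / 2) := Real.sin_pos_of_pos_of_lt_pi (by linarith) (by linarith)
  have c : Real.cos θ = 1 - 2 * Real.sin (θ/2)^2 := by
    have := Real.cos_two_mul' (θ/2)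
    rw [show 2 * (θ/2) = θ by ring] at this
    rw [this]; linarith [Real.cos_sq_add_sin_sq (θ/2)]
  have hn : ‖1 - r * Complex.exp (θ * Complex.I)‖ ^ 2 = (1 - r)^2 + 4 * r * Real.sin (θ/2)^2 := by
    rw [Complex.sq_norm, Complex.normSq_apply]
    simp [Complex.exp_ofReal_mul_I_re, Complex.exp_ofReal_mul_I_im]
    have := Real.cos_sq_add_sin_sq θ
    linear_combination r^2 * this - 2 * r * c
  have hl : Real.sin (θ/2) ≤ ‖1 - r * Complex.exp (θ * Complex.I)‖ := by
    refine (sq_le_sq₀ hs.le (norm_nonneg _)).1 ?_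
    rw [hn]; nlinarith [sq_nonneg (1 - r), sq_nonneg (Real.sin (θ/2))]
  have hu : ‖1 - r * Complex.exp (θ * Complex.I)‖ ≤ 2 := by
    refine (norm_sub_le _ _).trans ?_
    rw [norm_mul, Complex.norm_exp_ofReal_mul_I]
    simp [abs_of_nonneg (show 0 ≤ r by linarith)]; linarith
  have a1 := Real.log_le_log hs hl
  have a2 := Real.log_le_log (hs.trans_le hl) hu
  have := Real.log_two_lt_d9
  rw [abs_le]
  constructor
  · linarith [neg_abs_le (Real.log (Real.sin (θ/2)))]
  · linarith [abs_nonneg (Real.log (Real.sin (θ/2)))]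

lemma clog_bound {θ r : ℝ} (h0 : 0 < θ) (h1 : θ < 2 * π) (hr : 1/4 ≤ r) (hr1 : r < 1) :
    ‖Complex.log (1 - r * Complex.exp (θ * Complex.I))‖ ≤ 5 + |Real.log (Real.sin (θ / 2))| := by
  refine (Complex.norm_le_abs_re_add_abs_im _).trans ?_
  rw [Complex.log_re, Complex.log_im]
  have := log_norm_bound h0 h1 hr hr1
  have := Complex.abs_arg_le_pi (1 - r * Complex.exp (θ * Complex.I))
  linarith [Real.pi_le_four]

lemma ev_r : ∀ᶠ r : ℝ in 𝓝[<] 1, 1/4 ≤ r ∧ r < 1 := by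
  filter_upwards [Ioo_mem_nhdsLT (show (1/4:ℝ) < 1 by norm_num)] with r hr
  exact ⟨hr.1.le, hr.2⟩

lemma ae_ne_two_pi : ∀ᵐ x : ℝ ∂volume, x ≠ 2 * π := by
  simp [ae_iff]

lemma dct (w : ℝ → ℂ → ℝ) (hw : Measurable (Function.uncurry w)) (hwc : ∀ θ, Continuous (w θ))
    (hb : ∀ θ z, 0 < θ → θ < 2 * π → |w θ z| ≤ 16 * (1 + ‖z‖ ^ 3)) :
    Tendsto (fun r : ℝ => ∫ θ in (0:ℝ)..(2*π),
      w θ (Complex.log (1 - r * Complex.exp (θ * Complex.I)))) (𝓝[<] 1)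
      (𝓝 (∫ θ in (0:ℝ)..(2*π), w θ ((Real.log (2 * Real.sin (θ / 2)) : ℂ) +
        ((θ - π) / 2 : ℝ) * Complex.I))) := by
  apply intervalIntegral.tendsto_integral_filter_of_dominated_convergence
    (fun θ => 16 * (1 + 4 * (125 + |Real.log (Real.sin (θ / 2))| ^ 3)))
  · refine Eventually.of_forall fun r => Measurable.aestronglyMeasurable ?_
    exact hw.comp (measurable_id.prodMk (by fun_prop))
  · filter_upwards [ev_r] with r hr
    filter_upwards [ae_ne_two_pi] with θ hne hθ
    rw [Set.uIoc_of_le (by positivity)] at hθ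
    have hlt := lt_of_le_of_ne hθ.2 hne
    refine (hb _ _ hθ.1 hlt).trans ?_
    have h1 := clog_bound hθ.1 hlt hr.1 hr.2
    have h2 := pow_le_pow_left₀ (norm_nonneg _) h1 3
    have hk := abs_nonneg (Real.log (Real.sin (θ / 2)))
    set k := |Real.log (Real.sin (θ / 2))|
    have h3 : (5 + k)^3 ≤ 4 * (125 + k^3) := by nlinarith [mul_nonneg (add_nonneg (by norm_num : (0:ℝ) ≤ 5) hk) (sq_nonneg (k - 5))]
    linarith
  · exact (((intervalIntegrable_const.add ls_int_two).const_mul _ |> intervalIntegrable_const.add)).const_mul _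
  · filter_upwards [ae_ne_two_pi] with θ hne hθ
    rw [Set.uIoc_of_le (by positivity)] at hθ
    have hlt := lt_of_le_of_ne hθ.2 hne
    exact ((hwc θ).tendsto _).comp (lim_log hθ.1 hlt)

lemma slit_of_norm {z : ℂ} (h : ‖z‖ < 1) : 1 - z ∈ Complex.slitPlane := by
  left
  have := Complex.re_le_norm z
  simp; linarith

lemma mean_zero {r : ℝ} (h0 : 1/4 ≤ r) (h1 : r < 1) :
    ∫ θ in (0:ℝ)..(2*π), ((Complex.log (1 - r * Complex.exp (θ * Complex.I))) ^ 3).re = 0 := by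
  have hr : |r| = r := abs_of_nonneg (by linarith)
  have key : DiffContOnCl ℂ (fun z => (Complex.log (1 - z)) ^ 3) (Metric.ball 0 |r|) := by
    apply DifferentiableOn.diffContOnCl
    intro z hz
    have hz' := Metric.closure_ball_subset_closedBall hz
    rw [hr] at hz'
    have : ‖z‖ < 1 := by simp at hz'; linarith
    have := slit_of_norm this
    exact (DifferentiableAt.pow (DifferentiableAt.clog (by fun_prop) this) 3).differentiableWithinAt
  have h := key.circleAverage
  rw [Real.circleAverage_def] at h
  simp [circleMap, Real.pi_ne_zero] at h
  have hc : Continuous (fun θ : ℝ => (Complex.log (1 - r * Complex.exp (θ * Complex.I))) ^ 3) := by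
    refine Continuous.pow (Continuous.clog (by fun_prop) fun θ => ?_) 3
    apply slit_of_norm
    rw [norm_mul, Complex.norm_exp_ofReal_mul_I]; simp [hr, h1]
  have := Complex.reCLM.intervalIntegral_comp_comm (hc.intervalIntegrable (μ := volume) 0 (2*π))
  simpa [h] using this

lemma fourier_coeff (n : ℕ) : ∫ θ in (0:ℝ)..(2*π), (θ - π)^2 * Real.cos ((n+1) * θ) =
    4 * π / (n + 1 : ℝ)^2 := by
  have hn : (n + 1 : ℝ) ≠ 0 := by positivity
  have hd : ∀ θ ∈ Set.uIcc 0 (2*π), HasDerivAt (fun θ : ℝ => (θ - π)^2 * (Real.sin ((n+1) * θ) / (n+1))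
      + 2 * (θ - π) * (Real.cos ((n+1)*θ) / (n+1)^2) - 2 * (Real.sin ((n+1) * θ) / (n+1)^3))
      ((θ - π)^2 * Real.cos ((n+1) * θ)) θ := by
    intro θ _
    have hl : HasDerivAt (fun θ : ℝ => (n+1) * θ) (n+1) θ := by
      simpa using (hasDerivAt_id θ).const_mul ((n:ℝ)+1)
    have hp : HasDerivAt (fun θ : ℝ => θ - π) 1 θ := (hasDerivAt_id θ).sub_const π
    convert! (((hp.pow 2).mul (hl.sin.div_const (n+1))).add ((hp.const_mul 2).mul
      (hl.cos.div_const ((n+1)^2)))).sub ((hl.sin.div_const ((n+1)^3)).const_mul 2) using 1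
    simp
    field_simp
    ring
  rw [intervalIntegral.integral_eq_sub_of_hasDerivAt hd
    (Continuous.intervalIntegrable (by fun_prop) _ _)]
  have e1 : Real.cos ((n+1) * (2*π)) = 1 := by
    have := Real.cos_nat_mul_two_pi (n+1); push_cast at this; exact this
  have e2 : Real.sin ((n+1) * (2*π)) = 0 := by
    have := Real.sin_nat_mul_pi (2*(n+1)); push_cast at this; rw [← this]; ring_nf
  rw [e1, e2]; simp; field_simp; ring

lemma fourier_r {r : ℝ} (h0 : 1/4 ≤ r) (h1 : r < 1) :
    ∫ θ in (0:ℝ)..(2*π), (θ - π)^2 * (Complex.log (1 - r * Complex.exp (θ * Complex.I))).re =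
    -(4 * π * ∑' n : ℕ, r ^ (n+1) / (n + 1 : ℝ)^3) := by
  have hr : |r| = r := abs_of_nonneg (by linarith)
  have hr0 : 0 ≤ r := by linarith
  have hs : HasSum (fun n : ℕ => ∫ θ in (0:ℝ)..(2*π), (θ - π)^2 * (r^(n+1) / (n+1) * Real.cos ((n+1) * θ)))
     (∫ θ in (0:ℝ)..(2*π), (θ - π)^2 * -(Complex.log (1 - r * Complex.exp (θ * Complex.I))).re) := by
    apply intervalIntegral.hasSum_integral_of_dominated_convergence (fun n θ => 16 * r ^ n)
    · intro n; exact Continuous.aestronglyMeasurable (by fun_prop)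
    · intro n
      refine Eventually.of_forall fun θ hθ => ?_
      rw [Set.uIoc_of_le (by positivity)] at hθ
      rw [norm_mul, norm_mul, Real.norm_of_nonneg (sq_nonneg _), Real.norm_of_nonneg (by positivity)]
      have a1 : (θ - π)^2 ≤ 16 := by
        have := Real.pi_le_four
        nlinarith [hθ.1, hθ.2]
      have a2 : ‖Real.cos ((n+1) * θ)‖ ≤ 1 := Real.abs_cos_le_one _
      have a3 : r^(n+1) / (n+1) ≤ r^n := by
        rw [div_le_iff₀ (by positivity), pow_succ]
        have : 0 ≤ r^n := by positivity
        gcongr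
        have : (0:ℝ) ≤ n := by positivity
        linarith
      have := mul_le_mul a3 a2 (norm_nonneg _) (by positivity)
      rw [mul_one] at this
      exact mul_le_mul a1 this (by positivity) (by norm_num)
    · exact Eventually.of_forall fun θ _ => (summable_geometric_of_lt_one hr0 h1).mul_left _
    · exact intervalIntegrable_const
    · refine Eventually.of_forall fun θ _ => HasSum.mul_left _ ?_
      have hn : ‖(r:ℂ) * Complex.exp (θ * Complex.I)‖ < 1 := by
        rw [norm_mul, Complex.norm_exp_ofReal_mul_I]; simp [hr, h1]
      have := Complex.hasSum_re (Complex.hasSum_taylorSeries_neg_log' hn)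
      rw [Complex.neg_re] at this
      convert! this using 2 with n
      rw [mul_pow, ← Complex.exp_nat_mul, ← mul_assoc,
        show ((n+1:ℕ):ℂ) * θ = (((n+1) * θ : ℝ) : ℂ) by push_cast; ring,
        show (n+1:ℂ) = ((n+1 : ℝ) : ℂ) by push_cast; ring, Complex.div_ofReal_re,
        ← Complex.ofReal_pow, Complex.re_ofReal_mul, Complex.exp_ofReal_mul_I_re]
      ring
  have e : ∀ n : ℕ, ∫ θ in (0:ℝ)..(2*π), (θ - π)^2 * (r^(n+1) / (n+1) * Real.cos ((n+1) * θ)) =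
      4 * π * (r ^ (n+1) / (n + 1 : ℝ)^3) := by
    intro n
    have : ∀ θ : ℝ, (θ - π)^2 * (r^(n+1) / (n+1) * Real.cos ((n+1) * θ)) =
       r^(n+1) / (n+1) * ((θ - π)^2 * Real.cos ((n+1) * θ)) := fun θ => by ring
    simp_rw [this]
    rw [intervalIntegral.integral_const_mul, fourier_coeff]
    field_simp
  simp_rw [e] at hs
  have := hs.tsum_eq
  rw [tsum_mul_left] at this
  simp only [mul_neg, intervalIntegral.integral_neg] at this
  linarith

lemma zeta_lim : Tendsto (fun r : ℝ => -(4 * π * ∑' n : ℕ, r ^ (n+1) / (n + 1 : ℝ)^3)) (𝓝[<] 1)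
    (𝓝 (-(4 * π * zetaVal 3))) := by
  refine ((tendsto_tsum_of_dominated_convergence (bound := fun n : ℕ => 1 / (n+1:ℝ)^3) ?_ ?_ ?_).const_mul _).neg
  · have := (summable_nat_add_iff 1).2 (Real.summable_one_div_nat_pow.2 (show 1 < 3 by norm_num))
    simpa using this
  · intro n
    have : Continuous (fun r : ℝ => r^(n+1) / (n+1:ℝ)^3) := by fun_prop
    simpa using (this.tendsto 1).mono_left nhdsWithin_le_nhds
  · filter_upwards [ev_r] with r hr n
    have : 0 ≤ r := by linarith [hr.1]
    rw [Real.norm_of_nonneg (by positivity)]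
    gcongr
    exact pow_le_one₀ this hr.2.le

lemma I1 : ∫ θ in (0:ℝ)..(2*π), (θ - π)^2 * Real.log (2 * Real.sin (θ / 2)) = -(4 * π * zetaVal 3) := by
  have h := dct (fun θ z => (θ - π)^2 * z.re) (by dsimp [Function.uncurry_def]; fun_prop) (fun θ => by fun_prop) (by
    intro θ z h0 h1
    rw [abs_mul, abs_of_nonneg (sq_nonneg _)]
    have a1 : (θ - π)^2 ≤ 16 := by
      have := Real.pi_le_four
      nlinarith
    refine mul_le_mul a1 ?_ (abs_nonneg _) (by norm_num)
    refine (Complex.abs_re_le_norm z).trans ?_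
    have := norm_nonneg z
    rcases le_total ‖z‖ 1 with h | h
    · have : 0 ≤ ‖z‖^3 := by positivity
      linarith
    · nlinarith [le_self_pow₀ h (show 3 ≠ 0 by norm_num)])
  have h2 := h.congr' (by filter_upwards [ev_r] with r hr using fourier_r hr.1 hr.2)
  have := tendsto_nhds_unique h2 zeta_lim
  rw [← this]
  congr 1; ext θ
  simp

lemma cube_re (a b : ℝ) : (((a : ℂ) + b * Complex.I)^3).re = a^3 - 3 * a * b^2 := by
  simp [pow_succ]; ring

lemma I2 : ∫ θ in (0:ℝ)..(2*π), (Real.log (2 * Real.sin (θ / 2)) ^ 3 -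
     3 / 4 * ((θ - π)^2 * Real.log (2 * Real.sin (θ / 2)))) = 0 := by
  have h := dct (fun θ z => (z^3).re) (by dsimp [Function.uncurry_def]; fun_prop) (fun θ => by fun_prop) (by
    intro θ z h0 h1
    refine (Complex.abs_re_le_norm _).trans ?_
    rw [norm_pow]
    have : 0 ≤ ‖z‖^3 := by positivity
    linarith)
  have h2 := h.congr' (by filter_upwards [ev_r] with r hr using mean_zero hr.1 hr.2)
  have := tendsto_nhds_unique h2 tendsto_const_nhds
  rw [← this]
  congr 1; ext θ
  rw [cube_re]; ring

lemma log_two_mul_bound (s : ℝ) : |Real.log (2 * s)| ^ 3 ≤ 4 * (1 + |Real.log s| ^ 3) := by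
  have hk := abs_nonneg (Real.log s)
  have h1 : |Real.log (2 * s)| ≤ 1 + |Real.log s| := by
    rcases eq_or_ne s 0 with rfl | h
    · simp
    · rw [Real.log_mul (by norm_num) h]
      refine (abs_add_le _ _).trans ?_
      have := Real.log_two_lt_d9
      have h2 := Real.log_two_gt_d9
      rw [abs_of_pos (by linarith : 0 < Real.log 2)]
      linarith
  refine (pow_le_pow_left₀ (abs_nonneg _) h1 3).trans ?_
  set k := |Real.log s|
  nlinarith [mul_nonneg (add_nonneg zero_le_one hk) (sq_nonneg (k - 1))]

lemma ii_of_bound {f g : ℝ → ℝ} {p q : ℝ} (hg : IntervalIntegrable g volume p q) (hf : Measurable f)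
    (h : ∀ x, |f x| ≤ g x) : IntervalIntegrable f volume p q :=
  hg.mono_fun' hf.aestronglyMeasurable (Eventually.of_forall h)

lemma A_int : IntervalIntegrable (fun x => |Real.log (2 * Real.sin (x / 2))| ^ 3) volume 0 (2 * π) := by
  refine ii_of_bound ((intervalIntegrable_const (c := (1:ℝ)).add ls_int_two).const_mul 4) (by fun_prop) fun x => ?_
  rw [abs_of_nonneg (by positivity)]
  exact log_two_mul_bound _

lemma a_int : IntervalIntegrable (fun x => |Real.log (2 * Real.sin x)| ^ 3) volume 0 (π / 2) := by
  refine ii_of_bound ((intervalIntegrable_const (c := (1:ℝ)).add ls_int_half).const_mul 4) (by fun_prop) fun x => ?_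
  rw [abs_of_nonneg (by positivity)]
  exact log_two_mul_bound _

lemma b_int : IntervalIntegrable (fun x => |Real.log (2 * Real.cos x)| ^ 3) volume 0 (π / 2) := by
  refine ii_of_bound ((intervalIntegrable_const (c := (1:ℝ)).add lc_int_half).const_mul 4) (by fun_prop) fun x => ?_
  rw [abs_of_nonneg (by positivity)]
  exact log_two_mul_bound _

lemma cube_ge {u : ℝ} (hu : 0 ≤ u) : u ≤ 1 + u ^ 3 := by
  nlinarith [mul_nonneg (add_nonneg zero_le_one hu) (sq_nonneg (u - 1))]

lemma J_two_pi : ∫ θ in (0:ℝ)..(2*π), Real.log (2 * Real.sin (θ / 2)) ^ 3 = -(3 * π * zetaVal 3) := by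
  have h := I2
  rw [intervalIntegral.integral_sub, intervalIntegral.integral_const_mul, I1] at h
  · linarith
  · exact ii_of_bound A_int (by fun_prop) fun x => (abs_pow _ _).le
  · apply IntervalIntegrable.const_mul
    have : IntervalIntegrable (fun θ => Real.log (2 * Real.sin (θ / 2))) volume 0 (2 * π) :=
      ii_of_bound (intervalIntegrable_const (c := (1:ℝ)).add A_int) (by fun_prop)
        fun x => cube_ge (abs_nonneg _)
    exact this.continuousOn_mul (f := fun θ => Real.log (2 * Real.sin (θ / 2))) (by fun_prop)

/-- Interval integrability of `g (2 sin)` on `[0, π/2]` gives the doubled value on `[0, π]`. -/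
lemma double (g : ℝ → ℝ) (hg : IntervalIntegrable (fun x => g (Real.sin x)) volume 0 (π / 2)) :
    ∫ x in (0:ℝ)..π, g (Real.sin x) = 2 * ∫ x in (0:ℝ)..(π / 2), g (Real.sin x) := by
  have h2 : IntervalIntegrable (fun x => g (Real.sin x)) volume (π / 2) π := by
    have := (hg.comp_sub_left π (by simp)).symm
    simpa [Real.sin_pi_sub, show π - π / 2 = π / 2 by ring] using this
  rw [← intervalIntegral.integral_add_adjacent_intervals hg h2]
  have := intervalIntegral.integral_comp_sub_left (fun x => g (Real.sin x)) π (a := π / 2) (b := π)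
  simp only [Real.sin_pi_sub, sub_self, show π - π / 2 = π / 2 by ring] at this
  rw [this]; ring

lemma refl_cos (G : ℝ → ℝ → ℝ) : ∫ x in (0:ℝ)..(π / 2), G (Real.cos x) (Real.sin x) =
    ∫ x in (0:ℝ)..(π / 2), G (Real.sin x) (Real.cos x) := by
  have := intervalIntegral.integral_comp_sub_left (fun x => G (Real.sin x) (Real.cos x)) (π / 2)
    (a := 0) (b := π / 2)
  simpa [Real.sin_pi_div_two_sub, Real.cos_pi_div_two_sub] using this

lemma ae_ne_half : ∀ᵐ x : ℝ ∂volume, x ≠ π / 2 := by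
  simp [ae_iff]

lemma sum_arg (g : ℝ → ℝ)
    (hg : IntervalIntegrable (fun x => g (Real.log (2 * Real.sin x))) volume 0 (π / 2)) :
    ∫ x in (0:ℝ)..(π / 2), g (Real.log (2 * Real.sin x) + Real.log (2 * Real.cos x)) =
    ∫ x in (0:ℝ)..(π / 2), g (Real.log (2 * Real.sin x)) := by
  have h1 : ∫ x in (0:ℝ)..(π / 2), g (Real.log (2 * Real.sin x) + Real.log (2 * Real.cos x)) =
      ∫ x in (0:ℝ)..(π / 2), g (Real.log (2 * Real.sin (2 * x))) := by
    apply intervalIntegral.integral_congr_ae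
    filter_upwards [ae_ne_half] with x hne hx
    rw [Set.uIoc_of_le (by positivity)] at hx
    have hlt := lt_of_le_of_ne hx.2 hne
    have hs : 0 < Real.sin x := Real.sin_pos_of_pos_of_lt_pi hx.1 (by linarith [Real.pi_pos])
    have hc : 0 < Real.cos x := Real.cos_pos_of_mem_Ioo ⟨by linarith [hx.1, Real.pi_pos], hlt⟩
    rw [← Real.log_mul (by positivity) (by positivity), Real.sin_two_mul]
    congr 2; ring
  rw [h1, intervalIntegral.integral_comp_mul_left (fun x => g (Real.log (2 * Real.sin x))) two_ne_zero]
  rw [mul_zero, show 2 * (π / 2) = π by ring, double (fun s => g (Real.log (2 * s))) hg]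
  simp

lemma J_half : ∫ x in (0:ℝ)..(π / 2), Real.log (2 * Real.sin x) ^ 3 = -(3 * π / 4 * zetaVal 3) := by
  have h := J_two_pi
  rw [intervalIntegral.integral_comp_div (fun x => Real.log (2 * Real.sin x) ^ 3) two_ne_zero,
    zero_div, show 2 * π / 2 = π by ring, double (fun s => Real.log (2 * s) ^ 3)] at h
  · simp at h; linarith
  · exact ii_of_bound a_int (by fun_prop) fun x => (abs_pow _ _).le

lemma mono_int (f : ℝ → ℝ) (hf : Measurable f) (h : ∀ x, |f x| ≤
    1 + |Real.log (2 * Real.sin x)| ^ 3 + |Real.log (2 * Real.cos x)| ^ 3) :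
    IntervalIntegrable f volume 0 (π / 2) :=
  ii_of_bound ((intervalIntegrable_const.add a_int).add b_int) hf h

lemma sq_bd {u : ℝ} (hu : 0 ≤ u) : u ^ 2 ≤ 1 + u ^ 3 := by
  rcases le_total u 1 with h | h
  · nlinarith [pow_nonneg hu 3]
  · nlinarith [sq_nonneg u]

lemma uv2_bd {u v : ℝ} (hu : 0 ≤ u) (hv : 0 ≤ v) : u * v ^ 2 ≤ u ^ 3 + v ^ 3 := by
  rcases le_total u v with h | h
  · nlinarith [pow_nonneg hu 3, mul_le_mul_of_nonneg_right h (sq_nonneg v)]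
  · nlinarith [pow_nonneg hv 3, mul_le_mul_of_nonneg_left (pow_le_pow_left₀ hv h 2) hu]

lemma uv_bd {u v : ℝ} (hu : 0 ≤ u) (hv : 0 ≤ v) : u * v ≤ 1 + u ^ 3 + v ^ 3 := by
  have := sq_bd hu
  have := sq_bd hv
  nlinarith [sq_nonneg (u - v), pow_nonneg hu 3, pow_nonneg hv 3]

theorem stmt_13 :
    ∫ x in (0 : ℝ)..(π / 2), Real.log (Real.sin x) * (Real.log (Real.cos x)) ^ 2
    = π / 8 * zetaVal 3 - π / 2 * Real.log 2 ^ 3 := by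
  set l := Real.log 2 with hl
  obtain ⟨a, ha⟩ : ∃ a : ℝ → ℝ, a = fun x => Real.log (2 * Real.sin x) := ⟨_, rfl⟩
  obtain ⟨b, hb⟩ : ∃ b : ℝ → ℝ, b = fun x => Real.log (2 * Real.cos x) := ⟨_, rfl⟩
  have ma : Measurable a := by rw [ha]; fun_prop
  have mb : Measurable b := by rw [hb]; fun_prop
  have key : ∀ f : ℝ → ℝ, Measurable f → (∀ x, |f x| ≤ 1 + |a x| ^ 3 + |b x| ^ 3) →
      IntervalIntegrable f volume 0 (π / 2) := by
    intro f hf h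
    apply mono_int f hf
    simpa [ha, hb] using h
  have pa : ∀ x, 0 ≤ |a x| ^ 3 := fun x => by positivity
  have pb : ∀ x, 0 ≤ |b x| ^ 3 := fun x => by positivity
  have ia : IntervalIntegrable a volume 0 (π / 2) := key _ ma fun x => by
    linarith [cube_ge (abs_nonneg (a x)), pb x]
  have ib : IntervalIntegrable b volume 0 (π / 2) := key _ mb fun x => by
    linarith [cube_ge (abs_nonneg (b x)), pa x]
  have ia2 : IntervalIntegrable (fun x => a x ^ 2) volume 0 (π / 2) := key _ (by fun_prop) fun x => by
    rw [abs_pow]; linarith [sq_bd (abs_nonneg (a x)), pb x]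
  have ib2 : IntervalIntegrable (fun x => b x ^ 2) volume 0 (π / 2) := key _ (by fun_prop) fun x => by
    rw [abs_pow]; linarith [sq_bd (abs_nonneg (b x)), pa x]
  have ia3 : IntervalIntegrable (fun x => a x ^ 3) volume 0 (π / 2) := key _ (by fun_prop) fun x => by
    rw [abs_pow]; linarith [pb x]
  have ib3 : IntervalIntegrable (fun x => b x ^ 3) volume 0 (π / 2) := key _ (by fun_prop) fun x => by
    rw [abs_pow]; linarith [pa x]
  have iab : IntervalIntegrable (fun x => a x * b x) volume 0 (π / 2) := key _ (by fun_prop) fun x => by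
    rw [abs_mul]; exact uv_bd (abs_nonneg (a x)) (abs_nonneg (b x))
  have iab2 : IntervalIntegrable (fun x => a x * b x ^ 2) volume 0 (π / 2) := key _ (by fun_prop) fun x => by
    rw [abs_mul, abs_pow]; linarith [uv2_bd (abs_nonneg (a x)) (abs_nonneg (b x))]
  have iba2 : IntervalIntegrable (fun x => b x * a x ^ 2) volume 0 (π / 2) := key _ (by fun_prop) fun x => by
    rw [abs_mul, abs_pow]; linarith [uv2_bd (abs_nonneg (b x)) (abs_nonneg (a x))]
  have r1 : ∫ x in (0:ℝ)..(π / 2), b x = ∫ x in (0:ℝ)..(π / 2), a x := by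
    rw [ha, hb]; exact refl_cos (fun s _ => Real.log (2 * s))
  have r2 : ∫ x in (0:ℝ)..(π / 2), b x ^ 2 = ∫ x in (0:ℝ)..(π / 2), a x ^ 2 := by
    rw [ha, hb]; exact refl_cos (fun s _ => Real.log (2 * s) ^ 2)
  have r3 : ∫ x in (0:ℝ)..(π / 2), b x ^ 3 = ∫ x in (0:ℝ)..(π / 2), a x ^ 3 := by
    rw [ha, hb]; exact refl_cos (fun s _ => Real.log (2 * s) ^ 3)
  have r4 : ∫ x in (0:ℝ)..(π / 2), b x * a x ^ 2 = ∫ x in (0:ℝ)..(π / 2), a x * b x ^ 2 := by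
    rw [ha, hb]; exact refl_cos (fun s c => Real.log (2 * s) * Real.log (2 * c) ^ 2)
  have s1 : ∫ x in (0:ℝ)..(π / 2), (a x + b x) = ∫ x in (0:ℝ)..(π / 2), a x := by
    rw [ha] at ia; rw [ha, hb]; exact sum_arg (fun t => t) ia
  have s2 : ∫ x in (0:ℝ)..(π / 2), (a x + b x) ^ 2 = ∫ x in (0:ℝ)..(π / 2), a x ^ 2 := by
    rw [ha] at ia2; rw [ha, hb]; exact sum_arg (fun t => t ^ 2) ia2
  have s3 : ∫ x in (0:ℝ)..(π / 2), (a x + b x) ^ 3 = ∫ x in (0:ℝ)..(π / 2), a x ^ 3 := by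
    rw [ha] at ia3; rw [ha, hb]; exact sum_arg (fun t => t ^ 3) ia3
  have j3 : ∫ x in (0:ℝ)..(π / 2), a x ^ 3 = -(3 * π / 4 * zetaVal 3) := by
    rw [ha]; exact J_half
  rw [intervalIntegral.integral_add ia ib, r1] at s1
  have e2 : ∀ x, (a x + b x) ^ 2 = a x ^ 2 + b x ^ 2 + 2 * (a x * b x) := fun x => by ring
  simp_rw [e2] at s2
  rw [intervalIntegral.integral_add (ia2.add ib2) (iab.const_mul 2),
    intervalIntegral.integral_add ia2 ib2, intervalIntegral.integral_const_mul, r2] at s2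
  have e3 : ∀ x, (a x + b x) ^ 3 = a x ^ 3 + b x ^ 3 + 3 * (a x * b x ^ 2) + 3 * (b x * a x ^ 2) :=
    fun x => by ring
  simp_rw [e3] at s3
  rw [intervalIntegral.integral_add ((ia3.add ib3).add (iab2.const_mul 3)) (iba2.const_mul 3),
    intervalIntegral.integral_add (ia3.add ib3) (iab2.const_mul 3),
    intervalIntegral.integral_add ia3 ib3, intervalIntegral.integral_const_mul,
    intervalIntegral.integral_const_mul, r3, r4, j3] at s3
  have main : ∫ x in (0 : ℝ)..(π / 2), Real.log (Real.sin x) * (Real.log (Real.cos x)) ^ 2 =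
      ∫ x in (0 : ℝ)..(π / 2), (a x * b x ^ 2 + (-2 * l) * (a x * b x) + l ^ 2 * a x + (-l) * b x ^ 2
        + (2 * l ^ 2) * b x + (-l ^ 3)) := by
    apply intervalIntegral.integral_congr_ae
    filter_upwards [ae_ne_half] with x hne hx
    rw [Set.uIoc_of_le (by positivity)] at hx
    have hlt := lt_of_le_of_ne hx.2 hne
    have hs : 0 < Real.sin x := Real.sin_pos_of_pos_of_lt_pi hx.1 (by linarith [Real.pi_pos])
    have hc : 0 < Real.cos x := Real.cos_pos_of_mem_Ioo ⟨by linarith [hx.1, Real.pi_pos], hlt⟩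
    have ea : a x = l + Real.log (Real.sin x) := by
      rw [ha]; exact Real.log_mul (by norm_num) hs.ne'
    have eb : b x = l + Real.log (Real.cos x) := by
      rw [hb]; exact Real.log_mul (by norm_num) hc.ne'
    rw [ea, eb]; ring
  have i1 := iab2.add (iab.const_mul (-2 * l))
  have i2 := i1.add (ia.const_mul (l ^ 2))
  have i3 := i2.add (ib2.const_mul (-l))
  have i4 := i3.add (ib.const_mul (2 * l ^ 2))
  rw [main, intervalIntegral.integral_add i4 intervalIntegrable_const,
    intervalIntegral.integral_add i3 (ib.const_mul _),
    intervalIntegral.integral_add i2 (ib2.const_mul _),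
    intervalIntegral.integral_add i1 (ia.const_mul _),
    intervalIntegral.integral_add iab2 (iab.const_mul _)]
  simp only [intervalIntegral.integral_const_mul, intervalIntegral.integral_const, smul_eq_mul]
  rw [r1, r2]
  have z1 : ∫ x in (0:ℝ)..(π / 2), a x = 0 := by linarith
  rw [z1]
  linear_combination s3 / 6 - l * s2
end

section
/- ∫_0^{π/2} x ln^3(tan(x)) dx = (93/16)ζ(5) + (21/16)ζ(2)ζ(3). -/
open Real

open MeasureTheory Set Filter Topology

noncomputable def kA (s : ℝ) : ℝ := (log (1 + exp (-s)) - log (1 - exp (-s))) / 2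
noncomputable def kK (w : ℝ) : ℝ := 2 * exp (2 * w) / (1 + exp (2 * w)) ^ 2
noncomputable def kP (c q : ℝ) : ℝ :=
  ((1 - q) * log (1 + q) - (1 - q) * log (1 - q)) / 2 * (1 + q) * c ^ 2 /
    ((1 + c ^ 2) * (1 + q ^ 2 * c ^ 2)) - arctan (q * c) * c / (1 + c ^ 2)

lemma int_pow_exp (j : ℕ) (r : ℝ) (hr : 0 < r) :
    ∫ s in Ioi (0:ℝ), s ^ j * exp (-(r * s)) = j.factorial / r ^ (j + 1) := by
  have h := integral_rpow_mul_exp_neg_mul_Ioi (a := (j:ℝ) + 1) (r := r) (by positivity) hr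
  rw [Real.Gamma_nat_eq_factorial] at h
  simp only [add_sub_cancel_right, rpow_natCast] at h
  rw [h]
  have : (1 / r) ^ ((j:ℝ) + 1) = (1 / r) ^ (j + 1) := by
    rw [← rpow_natCast]; push_cast; rfl
  rw [this, one_div, inv_pow]; field_simp

lemma integrable_pow_exp (j : ℕ) (r : ℝ) (hr : 0 < r) :
    IntegrableOn (fun s : ℝ => s ^ j * exp (-(r * s))) (Ioi 0) := by
  apply Integrable.of_integral_ne_zero
  rw [int_pow_exp j r hr]; positivity

lemma summ_odd (m : ℕ) (hm : 2 ≤ m) : Summable (fun k : ℕ => 1 / (2 * (k:ℝ) + 1) ^ m) := by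
  have h1 : Summable (fun n : ℕ => 1 / (n:ℝ) ^ m) := Real.summable_one_div_nat_pow.2 (by omega)
  have h2 := h1.comp_injective (i := fun k : ℕ => 2 * k + 1) (fun a b h => by simpa using h)
  refine h2.congr (fun k => ?_)
  simp [Function.comp]

lemma summ_all (m : ℕ) (hm : 2 ≤ m) : Summable (fun k : ℕ => 1 / ((k:ℝ) + 1) ^ m) := by
  have h1 : Summable (fun n : ℕ => 1 / (n:ℝ) ^ m) := Real.summable_one_div_nat_pow.2 (by omega)
  have h2 := h1.comp_injective (i := fun k : ℕ => k + 1) (fun a b h => by simpa using h)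
  refine h2.congr (fun k => ?_)
  simp [Function.comp]

lemma tsum_odd (m : ℕ) (hm : 2 ≤ m) :
    ∑' k : ℕ, 1 / (2 * (k:ℝ) + 1) ^ m = (1 - 1 / 2 ^ m) * zetaVal m := by
  have h1 := summ_all m hm
  have he : ∀ k : ℕ, 1 / (((2 * k : ℕ):ℝ) + 1) ^ m = 1 / (2 * (k:ℝ) + 1) ^ m := by
    intro k; push_cast; rfl
  have ho : ∀ k : ℕ, 1 / (((2 * k + 1 : ℕ):ℝ) + 1) ^ m = 1 / 2 ^ m * (1 / ((k:ℝ) + 1) ^ m) := by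
    intro k; push_cast
    rw [show (2 * (k:ℝ) + 1 + 1) = 2 * (k + 1) by ring, mul_pow]; field_simp
  have h := tsum_even_add_odd (f := fun k : ℕ => 1 / ((k:ℝ) + 1) ^ m)
    (by simp_rw [he]; exact summ_odd m hm) (by simp_rw [ho]; exact h1.mul_left _)
  simp_rw [he, ho] at h
  rw [tsum_mul_left] at h
  unfold zetaVal
  linarith

lemma alt_sum : HasSum (fun k : ℕ => (-1:ℝ) ^ k * (1 / ((k:ℝ) + 1) ^ 2)) (zetaVal 2 / 2) := by
  have h1 := summ_all 2 le_rfl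
  have hs : Summable (fun k : ℕ => (-1:ℝ) ^ k * (1 / ((k:ℝ) + 1) ^ 2)) := by
    apply Summable.of_norm_bounded h1
    intro k; simp
  have he : ∀ k : ℕ, (-1:ℝ) ^ (2 * k) * (1 / (((2 * k : ℕ):ℝ) + 1) ^ 2) = 1 / (2 * (k:ℝ) + 1) ^ 2 := by
    intro k; push_cast; simp
  have ho : ∀ k : ℕ, (-1:ℝ) ^ (2 * k + 1) * (1 / (((2 * k + 1 : ℕ):ℝ) + 1) ^ 2) = (-1 / 4) * (1 / ((k:ℝ) + 1) ^ 2) := by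
    intro k; push_cast
    rw [show (2 * (k:ℝ) + 1 + 1) = 2 * (k + 1) by ring, mul_pow]; simp [pow_succ]; field_simp; norm_num
  have h := tsum_even_add_odd (f := fun k : ℕ => (-1:ℝ) ^ k * (1 / ((k:ℝ) + 1) ^ 2))
    (by simp_rw [he]; exact summ_odd 2 le_rfl) (by simp_rw [ho]; exact h1.mul_left _)
  simp_rw [he, ho] at h
  rw [tsum_mul_left, tsum_odd 2 le_rfl] at h
  rw [hs.hasSum_iff, ← h]
  unfold zetaVal
  ring

lemma kA_sum (s : ℝ) (hs : 0 < s) :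
    HasSum (fun k : ℕ => 1 / (2 * (k:ℝ) + 1) * exp (-((2 * k + 1) * s))) (kA s) := by
  have hq : exp (-s) < 1 := by simpa using hs
  have h := (hasSum_log_sub_log_of_abs_lt_one (x := exp (-s)) (by rwa [abs_of_pos (exp_pos _)])).div_const 2
  unfold kA
  convert! h using 2 with k
  rw [← exp_nat_mul]; push_cast
  rw [show (2 * (k:ℝ) + 1) * -s = -((2 * k + 1) * s) by ring]; ring

lemma kA_nonneg (s : ℝ) (hs : 0 < s) : 0 ≤ kA s :=
  (kA_sum s hs).nonneg (fun k => by positivity)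

lemma kA_mom (j : ℕ) : ∫ s in Ioi (0:ℝ), s ^ j * kA s
    = j.factorial * ∑' k : ℕ, 1 / (2 * (k:ℝ) + 1) ^ (j + 2) := by
  have hval : ∀ k : ℕ, ∫ s in Ioi (0:ℝ), 1 / (2 * (k:ℝ) + 1) * (s ^ j * exp (-((2 * k + 1) * s)))
     = j.factorial * (1 / (2 * (k:ℝ) + 1) ^ (j + 2)) := by
    intro k
    rw [integral_const_mul, int_pow_exp j _ (by positivity)]
    field_simp
    ring
  have h := hasSum_integral_of_summable_integral_norm (μ := volume.restrict (Ioi (0:ℝ)))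
    (F := fun (k : ℕ) (s : ℝ) => 1 / (2 * (k:ℝ) + 1) * (s ^ j * exp (-((2 * k + 1) * s))))
    (fun k => (integrable_pow_exp j _ (by positivity)).const_mul _) (by
      convert! (summ_odd (j + 2) (by omega)).mul_left (j.factorial : ℝ) using 2 with k
      rw [← hval k]
      refine setIntegral_congr_fun measurableSet_Ioi (fun s hs => ?_)
      have : (0:ℝ) < s := hs
      exact norm_of_nonneg (by positivity))
  simp_rw [hval] at h
  rw [← tsum_mul_left, h.tsum_eq]
  refine setIntegral_congr_fun measurableSet_Ioi (fun s hs => ?_)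
  have h2 := ((kA_sum s hs).mul_left (s ^ j)).tsum_eq
  rw [← h2]
  congr 1; ext k; ring

lemma kA_int (j : ℕ) : IntegrableOn (fun s => s ^ j * kA s) (Ioi 0) := by
  apply Integrable.of_integral_ne_zero
  rw [kA_mom, tsum_odd _ (by omega)]
  have h1 : (1:ℝ) / 2 ^ (j + 2) < 1 := by
    rw [div_lt_one (by positivity)]; exact one_lt_pow₀ (by norm_num) (by omega)
  have h2 : 0 < zetaVal (j + 2) :=
    (summ_all (j + 2) (by omega)).tsum_pos (fun i => by positivity) 0 (by positivity)
  have : 0 < 1 - (1:ℝ) / 2 ^ (j + 2) := by linarith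
  positivity

lemma kK_neg (w : ℝ) : kK (-w) = kK w := by
  unfold kK
  rw [show 2 * -w = -(2 * w) by ring, exp_neg]
  field_simp; ring

lemma kK_nonneg (w : ℝ) : 0 ≤ kK w := by unfold kK; positivity

lemma kK_abs (w : ℝ) : kK |w| = kK w := by
  rcases abs_choice w with h | h <;> rw [h]
  exact kK_neg w

lemma kK_le (w : ℝ) : kK w ≤ 2 * exp (-(2 * |w|)) := by
  rw [← kK_abs]
  unfold kK
  rw [exp_neg, div_le_iff₀ (by positivity)]
  have := exp_pos (2 * |w|)
  field_simp
  nlinarith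

lemma kK_cont : Continuous kK := by
  unfold kK
  refine Continuous.div (by fun_prop) (by fun_prop) (fun x => by positivity)

lemma kK_int (j : ℕ) : Integrable (fun w => w ^ j * kK w) := by
  have h : Integrable (fun w : ℝ => |w| ^ j * exp (-(2 * |w|))) := by
    apply Integrable.of_integral_ne_zero
    rw [integral_comp_abs (f := fun w => w ^ j * exp (-(2 * w))), int_pow_exp j 2 (by norm_num)]
    positivity
  refine (h.const_mul 2).mono' ((by have := kK_cont; fun_prop : Continuous _).aestronglyMeasurable) ?_
  refine Eventually.of_forall (fun w => ?_)
  rw [norm_mul, norm_pow, norm_of_nonneg (kK_nonneg w), Real.norm_eq_abs]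
  have := kK_le w
  have h3 : 0 ≤ |w| ^ j := by positivity
  nlinarith

lemma kK_odd (j : ℕ) (hj : Odd j) : ∫ w, w ^ j * kK w = 0 := by
  have h := integral_neg_eq_self (fun w => w ^ j * kK w) volume
  simp_rw [kK_neg, hj.neg_pow, neg_mul] at h
  rw [integral_neg] at h
  linarith

lemma kK_zero : ∫ w, kK w = 1 := by
  have h := integral_of_hasDerivAt_of_tendsto (f := fun w => -(1 + exp (2 * w))⁻¹) (f' := kK)
    (m := -(1 + 0)⁻¹) (n := -0) (fun w => ?_) (by simpa using kK_int 0) ?_ ?_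
  · rw [h]; norm_num
  · have h1 : HasDerivAt (fun w : ℝ => 1 + exp (2 * w)) (exp (2 * w) * (2 * 1)) w :=
      (((hasDerivAt_id w).const_mul 2).exp).const_add 1
    convert! (h1.inv (by positivity)).neg using 1
    unfold kK; ring
  · apply Tendsto.neg
    apply Tendsto.inv₀ _ (by norm_num)
    exact tendsto_const_nhds.add (tendsto_exp_atBot.comp (tendsto_id.const_mul_atBot (by norm_num)))
  · apply Tendsto.neg
    apply Tendsto.inv_tendsto_atTop
    exact tendsto_atTop_add_const_left _ _ (tendsto_exp_atTop.comp (tendsto_id.const_mul_atTop (by norm_num)))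

lemma kK_sum (w : ℝ) (hw : 0 < w) :
    HasSum (fun k : ℕ => (-1:ℝ) ^ k * (2 * (k + 1)) * exp (-((2 * (k + 1)) * w))) (kK w) := by
  have hq : exp (-(2 * w)) < 1 := by simpa using hw
  have h := (hasSum_coe_mul_geometric_of_norm_lt_one (r := -exp (-(2 * w))) (by
    rwa [norm_neg, norm_of_nonneg (exp_pos _).le]))
  rw [← hasSum_nat_add_iff' 1] at h
  have h := h.mul_left (-2)
  convert! h using 1
  · ext k
    rw [neg_pow (exp _), ← exp_nat_mul]; push_cast
    rw [show ((k:ℝ) + 1) * -(2 * w) = -(2 * (k + 1) * w) by ring]; ring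
  · simp [kK, exp_neg]
    field_simp
    ring
    

lemma kK_two : ∫ w, w ^ 2 * kK w = zetaVal 2 / 2 := by
  have h0 := integral_comp_abs (f := fun w => w ^ 2 * kK w)
  simp_rw [kK_abs, sq_abs] at h0
  have hval : ∀ k : ℕ, ∫ s in Ioi (0:ℝ), (-1:ℝ) ^ k * (2 * (k + 1)) * (s ^ 2 * exp (-((2 * (k + 1)) * s)))
     = 1 / 2 * ((-1:ℝ) ^ k * (1 / ((k:ℝ) + 1) ^ 2)) := by
    intro k
    rw [integral_const_mul, int_pow_exp 2 _ (by positivity)]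
    simp [Nat.factorial]
    field_simp
  have hval' : ∀ k : ℕ, ∫ s in Ioi (0:ℝ), ‖(-1:ℝ) ^ k * (2 * (k + 1)) * (s ^ 2 * exp (-((2 * (k + 1)) * s)))‖
     = 1 / 2 * (1 / ((k:ℝ) + 1) ^ 2) := by
    intro k
    have : ∀ s : ℝ, ‖(-1:ℝ) ^ k * (2 * (k + 1)) * (s ^ 2 * exp (-((2 * (k + 1)) * s)))‖ =
       (2 * ((k:ℝ) + 1)) * (s ^ 2 * exp (-((2 * (k + 1)) * s))) := by
      intro s
      rw [norm_mul, norm_mul, norm_pow, norm_neg, norm_one, one_pow, one_mul,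
        norm_of_nonneg (by positivity), norm_of_nonneg (by positivity)]
    simp_rw [this]
    rw [integral_const_mul, int_pow_exp 2 _ (by positivity)]
    simp [Nat.factorial]
    field_simp
  have h := hasSum_integral_of_summable_integral_norm (μ := volume.restrict (Ioi (0:ℝ)))
    (F := fun (k : ℕ) (s : ℝ) => (-1:ℝ) ^ k * (2 * (k + 1)) * (s ^ 2 * exp (-((2 * (k + 1)) * s))))
    (fun k => (integrable_pow_exp 2 _ (by positivity)).const_mul _) (by
      simp_rw [hval']
      exact (summ_all 2 le_rfl).mul_left _)
  simp_rw [hval] at h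
  have h3 := h.unique (alt_sum.mul_left (1 / 2))
  rw [h0, ← (by linarith : 2 * (1 / 2 * (zetaVal 2 / 2)) = zetaVal 2 / 2), ← h3]
  congr 1
  refine setIntegral_congr_fun measurableSet_Ioi (fun s hs => ?_)
  have h2 := ((kK_sum s hs).mul_left (s ^ 2)).tsum_eq
  rw [← h2]
  congr 1; ext k; ring


lemma kP_deriv (c q : ℝ) (hq0 : 0 < q) (hq1 : q < 1) :
    HasDerivAt (kP c) (-2 * q * c ^ 2 * ((log (1 + q) - log (1 - q)) / 2) / (1 + q ^ 2 * c ^ 2) ^ 2) q := by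
  have h1 : HasDerivAt (fun q : ℝ => 1 - q) (-1) q := by simpa using (hasDerivAt_id q).const_sub 1
  have h2 : HasDerivAt (fun q : ℝ => 1 + q) 1 q := by simpa using (hasDerivAt_id q).const_add 1
  have n1 : 1 - q ≠ 0 := by linarith
  have n2 : 1 + q ≠ 0 := by linarith
  have hq2 : HasDerivAt (fun q : ℝ => (1 + c ^ 2) * (1 + q ^ 2 * c ^ 2)) ((1 + c ^ 2) * (2 * q * c ^ 2)) q := by
    have := ((((hasDerivAt_pow 2 q).mul_const (c ^ 2)).const_add 1).const_mul (1 + c ^ 2))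
    simpa using this
  have ha : HasDerivAt (fun q : ℝ => arctan (q * c)) (1 / (1 + (q * c) ^ 2) * (1 * c)) q :=
    ((hasDerivAt_id q).mul_const c).arctan
  have hd : (1 + c ^ 2) * (1 + q ^ 2 * c ^ 2) ≠ 0 := by positivity
  have := ((((((h1.mul (h2.log n2)).sub (h1.mul (h1.log n1))).div_const 2).mul h2).mul_const (c ^ 2)).div hq2 hd).sub
    ((ha.mul_const c).div_const (1 + c ^ 2))
  refine HasDerivAt.congr_deriv this ?_
  have n3 : 1 + q ^ 2 * c ^ 2 ≠ 0 := by positivity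
  have n4 : 1 + c ^ 2 ≠ 0 := by positivity
  rw [mul_pow]
  simp only [Pi.mul_apply, Pi.sub_apply]
  generalize log (1 + q) = a
  generalize log (1 - q) = b
  field_simp
  ring

lemma kP_contAt (c : ℝ) (q : ℝ) (hq : 0 ≤ q) : ContinuousAt (kP c) q := by
  unfold kP
  have h1 : Continuous (fun q : ℝ => (1 - q) * log (1 - q)) :=
    continuous_mul_log.comp (by fun_prop : Continuous (fun q : ℝ => 1 - q))
  have n2 : 1 + q ≠ 0 := by linarith
  have hd : (1 + c ^ 2) * (1 + q ^ 2 * c ^ 2) ≠ 0 := by positivity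
  have h2 : ContinuousAt (fun q : ℝ => log (1 + q)) q := ContinuousAt.log (by fun_prop) n2
  have h3 : Continuous (fun q : ℝ => arctan (q * c) * c / (1 + c ^ 2)) := by fun_prop
  refine ContinuousAt.sub ?_ h3.continuousAt
  refine ContinuousAt.div ?_ (by fun_prop) hd
  have := h1.continuousAt (x := q)
  fun_prop

lemma kernel (u : ℝ) : ∫ s in Ioi (0:ℝ), kA s * kK (u - s) =
    arctan (exp u) * exp u / (1 + exp u ^ 2) := by
  have h := integral_Ioi_of_hasDerivAt_of_nonneg (a := 0) (g := fun s => kP (exp u) (exp (-s)))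
    (g' := fun s => kA s * kK (u - s)) (l := kP (exp u) 0) ?_ ?_ ?_ ?_
  · rw [h]; simp [kP]
  · apply ContinuousAt.continuousWithinAt
    exact ContinuousAt.comp (g := kP (exp u)) (kP_contAt _ _ (exp_pos _).le) (by fun_prop)
  · intro s hs
    have hs : 0 < s := hs
    have h1 := (kP_deriv (exp u) (exp (-s)) (exp_pos _) (by simpa using hs)).comp s ((hasDerivAt_neg s).exp)
    refine HasDerivAt.congr_deriv h1 ?_
    unfold kA kK
    rw [show 2 * (u - s) = 2 * u + 2 * (-s) by ring, exp_add, two_mul u, two_mul (-s), exp_add, exp_add]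
    field_simp
  · intro s hs
    exact mul_nonneg (kA_nonneg s hs) (kK_nonneg _)
  · exact (kP_contAt _ 0 le_rfl).tendsto.comp (tendsto_exp_neg_atTop_nhds_zero)

lemma change_var : ∫ x in (0 : ℝ)..(π / 2), x * (Real.log (Real.tan x)) ^ 3 =
    ∫ u, u ^ 3 * (arctan (exp u) * exp u / (1 + exp u ^ 2)) := by
  rw [intervalIntegral.integral_of_le (by positivity), integral_Ioc_eq_integral_Ioo]
  have him : (fun u => arctan (exp u)) '' univ = Ioo 0 (π / 2) := by
    ext x; constructor
    · rintro ⟨u, -, rfl⟩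
      exact ⟨by simpa using exp_pos u, arctan_lt_pi_div_two _⟩
    · rintro ⟨h0, h1⟩
      refine ⟨log (tan x), mem_univ _, ?_⟩
      simp only
      rw [exp_log (tan_pos_of_pos_of_lt_pi_div_two h0 h1), arctan_tan (by linarith) h1]
  rw [← him, integral_image_eq_integral_abs_deriv_smul (f' := fun u => 1 / (1 + exp u ^ 2) * exp u) MeasurableSet.univ
    (fun u _ => ((Real.hasDerivAt_exp u).arctan).hasDerivWithinAt)
    ((arctan_injective.comp exp_injective).injOn)]
  rw [setIntegral_univ]
  congr 1; ext u
  rw [tan_arctan, log_exp, abs_of_nonneg (by positivity), smul_eq_mul]; ring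

lemma fub : Integrable (Function.uncurry (fun s u : ℝ => u ^ 3 * (kA s * kK (u - s))))
    ((volume.restrict (Ioi (0:ℝ))).prod volume) := by
  have h : Integrable (fun z : ℝ × ℝ => (z.2 + z.1) ^ 3 * (kA z.1 * kK z.2))
      ((volume.restrict (Ioi (0:ℝ))).prod volume) := by
    have hh := fun i j => (kA_int i).mul_prod (kK_int j)
    have := (((hh 0 3).add ((hh 1 2).const_mul 3)).add ((hh 2 1).const_mul 3)).add (hh 3 0)
    refine this.congr (Eventually.of_forall fun z => ?_)
    simp only [Pi.add_apply]; ring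
  have h2 := (measurePreserving_prod_sub (volume.restrict (Ioi (0:ℝ))) (volume : Measure ℝ)).integrable_comp_of_integrable h
  refine h2.congr (Eventually.of_forall fun z => ?_)
  simp [Function.uncurry, Function.comp]

lemma inner_moment (s : ℝ) : ∫ u, u ^ 3 * (kA s * kK (u - s)) = s ^ 3 * kA s + 3 * (zetaVal 2 / 2) * (s ^ 1 * kA s) := by
  rw [← integral_add_right_eq_self _ s]
  have : ∀ w : ℝ, (w + s) ^ 3 * (kA s * kK (w + s - s)) = kA s * (w ^ 3 * kK w) + 3 * s * kA s * (w ^ 2 * kK w)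
     + 3 * s ^ 2 * kA s * (w ^ 1 * kK w) + s ^ 3 * kA s * (w ^ 0 * kK w) := by
    intro w; rw [add_sub_cancel_right]; ring
  simp_rw [this]
  have i := fun (c : ℝ) j => (kK_int j).const_mul c
  have i2 := (i (kA s) 3).add (i (3 * s * kA s) 2)
  have i3 := i2.add (i (3 * s ^ 2 * kA s) 1)
  simp only [Pi.add_def] at i2 i3
  rw [integral_add i3 (i _ _), integral_add i2 (i _ _),
    integral_add (i _ _) (i _ _)]
  simp_rw [integral_const_mul]
  rw [kK_odd 3 (by decide), kK_odd 1 (by decide), kK_two]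
  simp only [pow_zero, one_mul, kK_zero]
  ring

theorem stmt_14 :
    ∫ x in (0 : ℝ)..(π / 2), x * (Real.log (Real.tan x)) ^ 3
    = 93 / 16 * zetaVal 5 + 21 / 16 * zetaVal 2 * zetaVal 3 := by
  rw [change_var]
  simp_rw [← kernel, ← integral_const_mul]
  rw [← integral_integral_swap fub]
  simp_rw [inner_moment]
  rw [integral_add (kA_int 3) ((kA_int 1).const_mul _), integral_const_mul, kA_mom, kA_mom, tsum_odd _ (by omega),
    tsum_odd _ (by omega)]
  simp [Nat.factorial]
  ring
end

section
/- ∑_{k=1}^∞ 4^k / (k^3 · C(2k,k)) = −(7/2)ζ(3) + 6 ln(2) ζ(2). -/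
open Real

noncomputable def aa (k : ℕ) : ℝ := 4 ^ k / (Nat.centralBinom k : ℝ)

lemma aa_pos (k : ℕ) : 0 < aa k := by
  unfold aa
  have := Nat.centralBinom_pos k
  positivity

lemma aa_succ (k : ℕ) : aa (k + 1) * (2 * k + 1) = 2 * (k + 1) * aa k := by
  unfold aa
  have h1 : (0 : ℝ) < Nat.centralBinom k := by exact_mod_cast Nat.centralBinom_pos k
  have h2 : (0 : ℝ) < Nat.centralBinom (k + 1) := by exact_mod_cast Nat.centralBinom_pos (k + 1)
  have h : ((k : ℝ) + 1) * Nat.centralBinom (k + 1) = 2 * (2 * k + 1) * Nat.centralBinom k := by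
    exact_mod_cast Nat.succ_mul_centralBinom_succ k
  field_simp
  rw [pow_succ]
  linear_combination (-2 * 4 ^ k : ℝ) * h

lemma aa_sq_le (k : ℕ) : aa (k + 1) ^ 2 ≤ 4 * (k + 1) := by
  induction k with
  | zero => 
    have := aa_succ 0
    have h0 : aa 0 = 1 := by simp [aa]
    rw [h0] at this
    norm_num at this ⊢
    rw [this]; norm_num
  | succ k ih =>
    have h := aa_succ (k + 1)
    push_cast at h ⊢
    have hk : (0 : ℝ) ≤ k := Nat.cast_nonneg k
    have h3 : aa (k + 1 + 1) ^ 2 * (2 * (k + 1) + 1) ^ 2 = 4 * (k + 1 + 1) ^ 2 * aa (k + 1) ^ 2 := by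
      rw [← mul_pow, h]; ring
    have h4 : 4 * ((k : ℝ) + 1 + 1) ^ 2 * aa (k + 1) ^ 2 ≤ 4 * ((k : ℝ) + 1 + 1) ^ 2 * (4 * (k + 1)) := by
      gcongr
    have h5 : 4 * ((k : ℝ) + 1 + 1) ^ 2 * (4 * (k + 1)) ≤ (4 * (k + 1 + 1)) * (2 * (k + 1) + 1) ^ 2 := by
      nlinarith
    have h6 : (0 : ℝ) < (2 * (k + 1) + 1) ^ 2 := by positivity
    exact le_of_mul_le_mul_right (by linarith) h6

noncomputable def g0 (N : ℕ) (x : ℝ) : ℝ :=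
  ∑ k ∈ Finset.range N, aa (k + 1) / (k + 1) ^ 2 * sin x ^ (2 * (k + 1))

noncomputable def g1 (N : ℕ) (x : ℝ) : ℝ :=
  ∑ k ∈ Finset.range N, 2 * aa (k + 1) / (k + 1) * (sin x ^ (2 * k + 1) * cos x)

lemma g0_deriv (N : ℕ) (x : ℝ) : HasDerivAt (g0 N) (g1 N x) x := by
  unfold g0 g1
  apply HasDerivAt.fun_sum
  intro k _
  have h := ((hasDerivAt_sin x).pow (2 * (k + 1))).const_mul (aa (k + 1) / ((k : ℝ) + 1) ^ 2)
  refine h.congr_deriv ?_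
  have hk : (k : ℝ) + 1 ≠ 0 := by positivity
  have : 2 * (k + 1) - 1 = 2 * k + 1 := by omega
  rw [this]
  push_cast
  field_simp

lemma g1_deriv (N : ℕ) (x : ℝ) : HasDerivAt (g1 N) (4 - 4 * aa N * sin x ^ (2 * N)) x := by
  induction N with
  | zero =>
    have : g1 0 = fun _ => 0 := by funext x; simp [g1]
    rw [this]
    have h := hasDerivAt_const x (0 : ℝ)
    refine h.congr_deriv ?_
    simp [aa]
  | succ k ih =>
    have e : g1 (k + 1) = fun x => g1 k x + 2 * aa (k + 1) / (k + 1) * (sin x ^ (2 * k + 1) * cos x) := by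
      funext x; simp [g1, Finset.sum_range_succ]
    rw [e]
    have h := ((((hasDerivAt_sin x).pow (2 * k + 1)).mul (hasDerivAt_cos x)).const_mul
      (2 * aa (k + 1) / ((k : ℝ) + 1)))
    have h2 := ih.add h
    refine h2.congr_deriv ?_
    have hk : (k : ℝ) + 1 ≠ 0 := by positivity
    have ha := aa_succ k
    have hc : cos x ^ 2 = 1 - sin x ^ 2 := cos_sq' x
    simp only [Nat.add_sub_cancel]
    have ha' : aa k = aa (k + 1) * (2 * k + 1) / (2 * (k + 1)) := by
      rw [ha]; field_simp
    rw [ha']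
    simp only [Pi.pow_apply]
    push_cast
    have : sin x ^ (2 * k) * cos x * cos x = sin x ^ (2 * k) - sin x ^ (2 * k + 2) := by
      rw [pow_add]; linear_combination sin x ^ (2 * k) * hc
    field_simp
    rw [pow_succ _ (2 * k), show 2 * (k + 1) = 2 * k + 2 by ring, pow_add _ (2 * k) 2]
    linear_combination (4 * (2 * (k : ℝ) + 1) * aa (k + 1) * sin x ^ (2 * k)) * hc

lemma nonneg_of_second (f f' f'' : ℝ → ℝ) (X : ℝ) (hX : 0 ≤ X)
    (h1 : ∀ x, HasDerivAt f (f' x) x) (h2 : ∀ x, HasDerivAt f' (f'' x) x)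
    (h0 : f 0 = 0) (h0' : f' 0 = 0) (hn : ∀ x ∈ Set.Icc 0 X, 0 ≤ f'' x) : 0 ≤ f X := by
  have m1 : MonotoneOn f' (Set.Icc 0 X) :=
    monotoneOn_of_hasDerivWithinAt_nonneg (convex_Icc 0 X)
      (fun x _ => (h2 x).continuousAt.continuousWithinAt)
      (fun x _ => (h2 x).hasDerivWithinAt) (fun x hx => hn x (interior_subset hx))
  have p1 : ∀ x ∈ Set.Icc 0 X, 0 ≤ f' x := fun x hx => by
    rw [← h0']; exact m1 ⟨le_rfl, hX⟩ hx hx.1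
  have m0 : MonotoneOn f (Set.Icc 0 X) :=
    monotoneOn_of_hasDerivWithinAt_nonneg (convex_Icc 0 X)
      (fun x _ => (h1 x).continuousAt.continuousWithinAt)
      (fun x _ => (h1 x).hasDerivWithinAt) (fun x hx => p1 x (interior_subset hx))
  rw [← h0]; exact m0 ⟨le_rfl, hX⟩ ⟨hX, le_rfl⟩ hX

lemma g0_zero (N : ℕ) : g0 N 0 = 0 := by simp [g0]
lemma g1_zero (N : ℕ) : g1 N 0 = 0 := by simp [g1]

lemma g0_le (N : ℕ) (X : ℝ) (hX : 0 ≤ X) : g0 N X ≤ 2 * X ^ 2 := by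
  have := nonneg_of_second (fun x => 2 * x ^ 2 - g0 N x) (fun x => 4 * x - g1 N x)
    (fun x => 4 - (4 - 4 * aa N * sin x ^ (2 * N))) X hX
    (fun x => ((((hasDerivAt_id x).pow 2).const_mul 2).sub (g0_deriv N x)).congr_deriv
      (by simp; ring))
    (fun x => (((hasDerivAt_id x).const_mul 4).sub (g1_deriv N x)).congr_deriv (by simp))
    (by simp [g0_zero]) (by simp [g1_zero])
    (fun x _ => by
      have := (aa_pos N).le
      have h2 : 0 ≤ sin x ^ (2 * N) := by rw [pow_mul]; positivity
      have := mul_nonneg this h2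
      linarith)
  linarith

lemma g0_ge (N : ℕ) (X : ℝ) (hX : 0 ≤ X) (hX2 : X ≤ π / 2) :
    2 * X ^ 2 - g0 N X ≤ 2 * aa N * sin X ^ (2 * N) * X ^ 2 := by
  have := nonneg_of_second
    (fun x => 2 * aa N * sin X ^ (2 * N) * x ^ 2 - (2 * x ^ 2 - g0 N x))
    (fun x => 4 * aa N * sin X ^ (2 * N) * x - (4 * x - g1 N x))
    (fun x => 4 * aa N * sin X ^ (2 * N) - (4 - (4 - 4 * aa N * sin x ^ (2 * N)))) X hX
    (fun x => ((((hasDerivAt_id x).pow 2).const_mul _).sub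
      ((((hasDerivAt_id x).pow 2).const_mul 2).sub (g0_deriv N x))).congr_deriv
      (by simp; ring))
    (fun x => (((hasDerivAt_id x).const_mul _).sub
      (((hasDerivAt_id x).const_mul 4).sub (g1_deriv N x))).congr_deriv (by simp))
    (by simp [g0_zero]) (by simp [g1_zero])
    (fun x hx => by
      have h1 := (aa_pos N).le
      have h2 : sin x ^ (2 * N) ≤ sin X ^ (2 * N) := by
        apply pow_le_pow_left₀
        · exact sin_nonneg_of_nonneg_of_le_pi hx.1 (by linarith [hx.2, pi_pos])
        · exact sin_le_sin_of_le_of_le_pi_div_two (by linarith [hx.1, pi_pos]) hX2 hx.2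
      have := mul_le_mul_of_nonneg_left h2 h1
      linarith)
  linarith

noncomputable def GG (x : ℝ) : ℝ := x / sinc x
noncomputable def FF (x : ℝ) : ℝ := GG x * cos x

lemma sinc_ne {x : ℝ} (hx : x ∈ Set.uIcc 0 (π / 2)) : sinc x ≠ 0 := by
  rw [Set.uIcc_of_le (by positivity)] at hx
  by_cases h : x = 0
  · simp [h]
  · rw [sinc_of_ne_zero h]
    have hp : 0 < x := lt_of_le_of_ne hx.1 (Ne.symm h)
    have := sin_pos_of_pos_of_lt_pi hp (by linarith [hx.2, pi_pos])
    positivity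

lemma GG_mul_sin {x : ℝ} (hx : 0 < x) (hx2 : x ≤ π / 2) : GG x = x ^ 2 / sin x := by
  unfold GG
  rw [sinc_of_ne_zero hx.ne']
  have := sin_pos_of_pos_of_lt_pi hx (by linarith [pi_pos])
  field_simp

lemma GG_cont : ContinuousOn GG (Set.uIcc 0 (π / 2)) := by
  unfold GG
  exact continuousOn_id.div continuous_sinc.continuousOn (fun x hx => sinc_ne hx)

lemma FF_cont : ContinuousOn FF (Set.uIcc 0 (π / 2)) :=
  GG_cont.mul continuous_cos.continuousOn

lemma int_sin_cos (k : ℕ) : ∫ x in (0 : ℝ)..(π / 2), sin x ^ (2 * k + 1) * cos x = 1 / (2 * (k + 1)) := by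
  rw [intervalIntegral.integral_eq_sub_of_hasDerivAt
    (f := fun x => sin x ^ (2 * k + 2) / (2 * (k + 1)))]
  · simp
  · intro x _
    have h := ((hasDerivAt_sin x).pow (2 * k + 2)).div_const (2 * ((k : ℝ) + 1))
    refine h.congr_deriv ?_
    have hk : (k : ℝ) + 1 ≠ 0 := by positivity
    have : 2 * k + 2 - 1 = 2 * k + 1 := by omega
    rw [this]
    push_cast
    field_simp
  · exact (by fun_prop : Continuous fun x => sin x ^ (2 * k + 1) * cos x).intervalIntegrable _ _

noncomputable def TT (N : ℕ) (x : ℝ) : ℝ :=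
  ∑ k ∈ Finset.range N, aa (k + 1) / (k + 1) ^ 2 * (sin x ^ (2 * k + 1) * cos x)

lemma TT_cont (N : ℕ) : Continuous (TT N) := by unfold TT; fun_prop

lemma TT_sin (N : ℕ) (x : ℝ) : TT N x * sin x = g0 N x * cos x := by
  unfold TT g0
  rw [Finset.sum_mul, Finset.sum_mul]
  refine Finset.sum_congr rfl fun k _ => ?_
  ring

lemma TT_int (N : ℕ) : ∫ x in (0 : ℝ)..(π / 2), TT N x =
    (∑ k ∈ Finset.range N, aa (k + 1) / (k + 1) ^ 3) / 2 := by
  unfold TT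
  rw [intervalIntegral.integral_finsetSum]
  · rw [Finset.sum_div]
    refine Finset.sum_congr rfl fun k _ => ?_
    rw [intervalIntegral.integral_const_mul, int_sin_cos]
    have hk : (k : ℝ) + 1 ≠ 0 := by positivity
    field_simp
  · intro k _
    exact Continuous.intervalIntegrable (by fun_prop) _ _

lemma TT_bounds (M : ℕ) {x : ℝ} (hx : x ∈ Set.Icc 0 (π / 2)) :
    0 ≤ 2 * FF x - TT (M + 1) x ∧
    2 * FF x - TT (M + 1) x ≤ 2 * aa (M + 1) * (π / 2) ^ 2 * (sin x ^ (2 * M + 1) * cos x) := by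
  by_cases h : x = 0
  · subst h; simp [FF, GG, TT]
  have hp : 0 < x := lt_of_le_of_ne hx.1 (Ne.symm h)
  have hs := sin_pos_of_pos_of_lt_pi hp (by linarith [hx.2, pi_pos])
  have hc : 0 ≤ cos x := cos_nonneg_of_mem_Icc ⟨by linarith [pi_pos], hx.2⟩
  have hF : FF x * sin x = x ^ 2 * cos x := by
    unfold FF; rw [GG_mul_sin hp hx.2]; field_simp
  have e : (2 * FF x - TT (M + 1) x) * sin x = (2 * x ^ 2 - g0 (M + 1) x) * cos x := by
    rw [sub_mul, TT_sin, mul_assoc, hF]; ring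
  have l := g0_le (M + 1) x hx.1
  have u := g0_ge (M + 1) x hx.1 hx.2
  constructor
  · refine le_of_mul_le_mul_right ?_ hs
    rw [zero_mul, e]
    exact mul_nonneg (by linarith) hc
  · refine le_of_mul_le_mul_right ?_ hs
    rw [e]
    have hx2 : x ^ 2 ≤ (π / 2) ^ 2 := pow_le_pow_left₀ hx.1 hx.2 2
    have ha := aa_pos (M + 1)
    calc (2 * x ^ 2 - g0 (M + 1) x) * cos x
        ≤ (2 * aa (M + 1) * sin x ^ (2 * (M + 1)) * x ^ 2) * cos x := by gcongr
      _ ≤ (2 * aa (M + 1) * sin x ^ (2 * (M + 1)) * (π / 2) ^ 2) * cos x := by gcongr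
      _ = _ := by ring

lemma FF_ii : IntervalIntegrable FF MeasureTheory.volume 0 (π / 2) := FF_cont.intervalIntegrable
lemma GG_ii : IntervalIntegrable GG MeasureTheory.volume 0 (π / 2) := GG_cont.intervalIntegrable

lemma partial_bounds (M : ℕ) :
    0 ≤ 4 * (∫ x in (0 : ℝ)..(π / 2), FF x) - ∑ k ∈ Finset.range (M + 1), aa (k + 1) / (k + 1) ^ 3 ∧
    4 * (∫ x in (0 : ℝ)..(π / 2), FF x) - ∑ k ∈ Finset.range (M + 1), aa (k + 1) / (k + 1) ^ 3
      ≤ π ^ 2 / √(M + 1) := by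
  have hp : (0 : ℝ) ≤ π / 2 := by positivity
  have ii : IntervalIntegrable (fun x => 2 * FF x - TT (M + 1) x) MeasureTheory.volume 0 (π / 2) :=
    (FF_ii.const_mul 2).sub ((TT_cont _).intervalIntegrable _ _)
  have e : ∫ x in (0 : ℝ)..(π / 2), (2 * FF x - TT (M + 1) x) =
      2 * (∫ x in (0 : ℝ)..(π / 2), FF x) -
      (∑ k ∈ Finset.range (M + 1), aa (k + 1) / (k + 1) ^ 3) / 2 := by
    rw [intervalIntegral.integral_sub (FF_ii.const_mul 2) ((TT_cont _).intervalIntegrable _ _),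
      TT_int, intervalIntegral.integral_const_mul]
  have l : 0 ≤ ∫ x in (0 : ℝ)..(π / 2), (2 * FF x - TT (M + 1) x) :=
    intervalIntegral.integral_nonneg hp fun x hx => (TT_bounds M hx).1
  have u : ∫ x in (0 : ℝ)..(π / 2), (2 * FF x - TT (M + 1) x) ≤
      ∫ x in (0 : ℝ)..(π / 2), 2 * aa (M + 1) * (π / 2) ^ 2 * (sin x ^ (2 * M + 1) * cos x) :=
    intervalIntegral.integral_mono_on hp ii
      (Continuous.intervalIntegrable (by fun_prop) _ _) fun x hx => (TT_bounds M hx).2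
  rw [intervalIntegral.integral_const_mul, int_sin_cos] at u
  rw [e] at l u
  refine ⟨by linarith, ?_⟩
  have hM : (0 : ℝ) < (M : ℝ) + 1 := by positivity
  have ha : aa (M + 1) ≤ 2 * √(M + 1) := by
    apply le_of_sq_le_sq _ (by positivity)
    rw [mul_pow, Real.sq_sqrt hM.le]
    linarith [aa_sq_le M]
  have : 2 * (2 * aa (M + 1) * (π / 2) ^ 2 * (1 / (2 * (M + 1)))) ≤ π ^ 2 / √(M + 1) := by
    have h1 : 2 * (2 * aa (M + 1) * (π / 2) ^ 2 * (1 / (2 * ((M : ℝ) + 1)))) =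
      π ^ 2 * (aa (M + 1) / 2 / (M + 1)) := by field_simp
    rw [h1, div_eq_mul_one_div (π ^ 2)]
    apply mul_le_mul_of_nonneg_left _ (by positivity)
    rw [div_le_div_iff₀ hM (by positivity)]
    have := Real.mul_self_sqrt hM.le
    nlinarith [Real.sqrt_nonneg ((M : ℝ) + 1)]
  linarith

lemma partial_tendsto : Filter.Tendsto
    (fun N => ∑ k ∈ Finset.range N, aa (k + 1) / ((k : ℝ) + 1) ^ 3) Filter.atTop
    (nhds (4 * ∫ x in (0 : ℝ)..(π / 2), FF x)) := by
  rw [← Filter.tendsto_add_atTop_iff_nat 1]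
  have h0 : Filter.Tendsto (fun M : ℕ => π ^ 2 / √((M : ℝ) + 1)) Filter.atTop (nhds 0) := by
    apply Filter.Tendsto.div_atTop tendsto_const_nhds
    apply Real.tendsto_sqrt_atTop.comp
    exact Filter.tendsto_atTop_add_const_right _ _ tendsto_natCast_atTop_atTop
  have h1 := squeeze_zero (fun M => (partial_bounds M).1) (fun M => (partial_bounds M).2) h0
  have h2 := (tendsto_const_nhds (x := 4 * ∫ x in (0 : ℝ)..(π / 2), FF x)).sub h1
  simpa using h2

/-! Fourier part -/

lemma kernel_s16 (N : ℕ) (x : ℝ) :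
    (∑ n ∈ Finset.range N, 2 * sin (2 * (n + 1) * x)) * sin x = cos x - cos ((2 * N + 1) * x) := by
  induction N with
  | zero => simp
  | succ N ih =>
    rw [Finset.sum_range_succ, add_mul, ih]
    push_cast
    have h1 : (2 * (N : ℝ) + 1) * x = 2 * (N + 1) * x - x := by ring
    have h2 : (2 * ((N : ℝ) + 1) + 1) * x = 2 * (N + 1) * x + x := by ring
    rw [h1, h2, cos_sub, cos_add]
    ring

lemma FF_eq (N : ℕ) {x : ℝ} (hx : x ∈ Set.Icc 0 (π / 2)) :
    FF x = (∑ n ∈ Finset.range N, 2 * (x ^ 2 * sin (2 * (n + 1) * x))) + GG x * cos ((2 * N + 1) * x) := by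
  by_cases h : x = 0
  · subst h; simp [FF, GG]
  have hp : 0 < x := lt_of_le_of_ne hx.1 (Ne.symm h)
  have hs := sin_pos_of_pos_of_lt_pi hp (by linarith [hx.2, pi_pos])
  have k := kernel_s16 N x
  have e : ∑ n ∈ Finset.range N, 2 * (x ^ 2 * sin (2 * (n + 1) * x)) =
      x ^ 2 * ∑ n ∈ Finset.range N, 2 * sin (2 * (n + 1) * x) := by
    rw [Finset.mul_sum]; exact Finset.sum_congr rfl fun _ _ => by ring
  rw [e]
  unfold FF
  rw [GG_mul_sin hp hx.2]
  generalize ∑ n ∈ Finset.range N, 2 * sin (2 * ((n : ℝ) + 1) * x) = A at *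
  generalize cos ((2 * (N : ℝ) + 1) * x) = B at *
  field_simp
  linear_combination -k

lemma int_sq_sin (n : ℕ) : ∫ x in (0 : ℝ)..(π / 2), x ^ 2 * sin (2 * (n + 1) * x) =
    -(π ^ 2 / 8) * (-1) ^ (n + 1) / (n + 1) + ((-1) ^ (n + 1) - 1) / (4 * (n + 1) ^ 3) := by
  have hn : (n : ℝ) + 1 ≠ 0 := by positivity
  rw [intervalIntegral.integral_eq_sub_of_hasDerivAt
    (f := fun x => -(x ^ 2 * cos (2 * (n + 1) * x) / (2 * (n + 1))) +
      x * sin (2 * (n + 1) * x) / (2 * (n + 1) ^ 2) + cos (2 * (n + 1) * x) / (4 * (n + 1) ^ 3))]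
  · have h1 : 2 * ((n : ℝ) + 1) * (π / 2) = ((n + 1 : ℕ) : ℝ) * π := by push_cast; ring
    simp only [h1, cos_nat_mul_pi, sin_nat_mul_pi]
    simp
    field_simp
    ring
  · intro x _
    have hl : HasDerivAt (fun x : ℝ => 2 * ((n : ℝ) + 1) * x) (2 * ((n : ℝ) + 1)) x := by
      simpa using (hasDerivAt_id x).const_mul (2 * ((n : ℝ) + 1))
    have hc := hl.cos
    have hs := hl.sin
    have hx := hasDerivAt_id x
    have h := ((((hx.pow 2).mul hc).div_const (2 * ((n : ℝ) + 1))).neg.add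
      ((hx.mul hs).div_const (2 * ((n : ℝ) + 1) ^ 2))).add (hc.div_const (4 * ((n : ℝ) + 1) ^ 3))
    refine h.congr_deriv ?_
    simp
    field_simp
    ring
  · exact Continuous.intervalIntegrable (by fun_prop) _ _

lemma RL : Filter.Tendsto (fun N : ℕ => ∫ x in (0 : ℝ)..(π / 2), GG x * cos ((2 * (2 * N : ℕ) + 1) * x))
    Filter.atTop (nhds 0) := by
  have hp : (0 : ℝ) ≤ π / 2 := by positivity
  have h := Real.tendsto_integral_exp_smul_cocompact
    (fun x => ((Set.Ioc (0 : ℝ) (π / 2)).indicator (fun x => (GG x : ℂ)) x))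
  have hw : Filter.Tendsto (fun N : ℕ => (2 * ((2 * N : ℕ) : ℝ) + 1) / (2 * π)) Filter.atTop
      (Filter.cocompact ℝ) := by
    refine Filter.Tendsto.mono_right ?_ atTop_le_cocompact
    apply Filter.Tendsto.atTop_div_const (by positivity)
    apply Filter.tendsto_atTop_add_const_right
    apply Filter.Tendsto.const_mul_atTop (by norm_num)
    refine tendsto_natCast_atTop_atTop.comp ?_
    exact Filter.tendsto_id.const_mul_atTop' (by norm_num)
  have h2 := (Complex.continuous_re.tendsto 0).comp (h.comp hw)
  simp only [Complex.zero_re] at h2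
  refine h2.congr fun N => ?_
  simp only [Function.comp]
  set w : ℝ := 2 * ((2 * N : ℕ) : ℝ) + 1 with hwdef
  have e1 : ∀ v : ℝ, Real.fourierChar (-(v * (w / (2 * π)))) •
      (Set.Ioc (0 : ℝ) (π / 2)).indicator (fun x => (GG x : ℂ)) v =
      (Set.Ioc (0 : ℝ) (π / 2)).indicator
        (fun x => Complex.exp (((-(w * x) : ℝ) : ℂ) * Complex.I) * (GG x : ℂ)) v := by
    intro v
    by_cases hv : v ∈ Set.Ioc (0 : ℝ) (π / 2)
    · rw [Set.indicator_of_mem hv, Set.indicator_of_mem hv, Circle.smul_def, Real.fourierChar_apply,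
        smul_eq_mul]
      congr 4
      field_simp
    · rw [Set.indicator_of_notMem hv, Set.indicator_of_notMem hv, smul_zero]
  simp_rw [e1]
  rw [MeasureTheory.integral_indicator measurableSet_Ioc, intervalIntegral.integral_of_le hp]
  have hint : MeasureTheory.IntegrableOn
      (fun x => Complex.exp (((-(w * x) : ℝ) : ℂ) * Complex.I) * (GG x : ℂ))
      (Set.Ioc (0 : ℝ) (π / 2)) := by
    rw [← intervalIntegrable_iff_integrableOn_Ioc_of_le hp]
    apply ContinuousOn.intervalIntegrable
    apply ContinuousOn.mul
    · exact Continuous.continuousOn (by fun_prop)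
    · exact Complex.continuous_ofReal.comp_continuousOn GG_cont
  have := integral_re hint
  refine Eq.trans this.symm ?_
  refine MeasureTheory.integral_congr_ae (Filter.Eventually.of_forall fun x => ?_)
  simp only [RCLike.re_to_complex, Complex.re_mul_ofReal, Complex.exp_ofReal_mul_I_re, cos_neg]
  ring

lemma FF_int (N : ℕ) : ∫ x in (0 : ℝ)..(π / 2), FF x =
    (∑ n ∈ Finset.range N, 2 * (-(π ^ 2 / 8) * (-1) ^ (n + 1) / (n + 1) +
      ((-1) ^ (n + 1) - 1) / (4 * ((n : ℝ) + 1) ^ 3))) +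
    ∫ x in (0 : ℝ)..(π / 2), GG x * cos ((2 * N + 1) * x) := by
  have hp : (0 : ℝ) ≤ π / 2 := by positivity
  rw [intervalIntegral.integral_congr (g := fun x =>
    (∑ n ∈ Finset.range N, 2 * (x ^ 2 * sin (2 * (n + 1) * x))) + GG x * cos ((2 * N + 1) * x))
    (fun x hx => FF_eq N (by rwa [Set.uIcc_of_le hp] at hx))]
  rw [intervalIntegral.integral_add, intervalIntegral.integral_finsetSum]
  · congr 1
    refine Finset.sum_congr rfl fun n _ => ?_
    rw [intervalIntegral.integral_const_mul, int_sq_sin]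
  · intro k _
    exact Continuous.intervalIntegrable (by fun_prop) _ _
  · exact Continuous.intervalIntegrable (by fun_prop) _ _
  · apply ContinuousOn.intervalIntegrable
    exact GG_cont.mul (Continuous.continuousOn (by fun_prop))

noncomputable def ZZ (N : ℕ) : ℝ := ∑ n ∈ Finset.range N, 1 / ((n : ℝ) + 1) ^ 3

lemma sum_even (M : ℕ) :
    (∑ n ∈ Finset.range (2 * M), 2 * (-(π ^ 2 / 8) * (-1) ^ (n + 1) / (n + 1) +
      ((-1) ^ (n + 1) - 1) / (4 * ((n : ℝ) + 1) ^ 3))) =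
    π ^ 2 / 4 * ((harmonic (2 * M) : ℝ) - (harmonic M : ℝ)) - (ZZ (2 * M) - ZZ M / 8) := by
  induction M with
  | zero => simp [ZZ]
  | succ M ih =>
    have e : 2 * (M + 1) = 2 * M + 1 + 1 := by ring
    unfold ZZ at ih ⊢
    rw [e, Finset.sum_range_succ, Finset.sum_range_succ, ih, harmonic_succ, harmonic_succ,
      harmonic_succ, Finset.sum_range_succ _ (2 * M + 1), Finset.sum_range_succ _ (2 * M),
      Finset.sum_range_succ _ M]
    have p1 : (-1 : ℝ) ^ (2 * M + 1) = -1 := by rw [pow_succ, pow_mul]; simp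
    have p2 : (-1 : ℝ) ^ (2 * M + 1 + 1) = 1 := by rw [pow_succ, p1]; simp
    rw [p1, p2]
    push_cast
    have h2 : (2 * (M : ℝ) + 1 + 1) = 2 * (M + 1) := by ring
    rw [h2]
    have hM : (M : ℝ) + 1 ≠ 0 := by positivity
    have hM2 : 2 * (M : ℝ) + 1 ≠ 0 := by positivity
    field_simp
    ring

lemma zz_tendsto : Filter.Tendsto ZZ Filter.atTop (nhds (zetaVal 3)) := by
  have hs : Summable (fun n : ℕ => 1 / ((n : ℝ) + 1) ^ 3) := by
    have := (summable_nat_add_iff 1).2 (Real.summable_one_div_nat_pow.2 (by norm_num : 1 < 3))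
    simpa using this
  exact hs.hasSum.tendsto_sum_nat

lemma zeta_two_val : zetaVal 2 = π ^ 2 / 6 := by
  have h := (hasSum_nat_add_iff' 1).2 hasSum_zeta_two
  unfold zetaVal
  simpa using h.tsum_eq

lemma two_mul_tendsto : Filter.Tendsto (fun M : ℕ => 2 * M) Filter.atTop Filter.atTop :=
  Filter.tendsto_id.const_mul_atTop' (by norm_num)

lemma harm_tendsto : Filter.Tendsto (fun M : ℕ => (harmonic (2 * M) : ℝ) - (harmonic M : ℝ))
    Filter.atTop (nhds (log 2)) := by
  have h1 := Real.tendsto_harmonic_sub_log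
  have h2 := h1.comp two_mul_tendsto
  have h3 := (h2.sub h1).add_const (log 2)
  simp only [sub_self, zero_add] at h3
  refine h3.congr' ?_
  filter_upwards [Filter.eventually_gt_atTop 0] with M hM
  have hM' : (M : ℝ) ≠ 0 := by positivity
  simp only [Function.comp]
  push_cast
  rw [log_mul (by norm_num) hM']
  ring

lemma FF_val : ∫ x in (0 : ℝ)..(π / 2), FF x = π ^ 2 / 4 * log 2 - 7 / 8 * zetaVal 3 := by
  have h := ((harm_tendsto.const_mul (π ^ 2 / 4)).sub
    ((zz_tendsto.comp two_mul_tendsto).sub (zz_tendsto.div_const 8))).add RL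
  have h2 := tendsto_nhds_unique (h.congr (fun M => by
    have := FF_int (2 * M)
    rw [sum_even] at this
    exact this.symm)) tendsto_const_nhds
  linarith

theorem stmt_16 :
    ∑' k : ℕ, (4 : ℝ) ^ (k + 1) /
      ((k + 1 : ℝ) ^ 3 * (Nat.choose (2 * (k + 1)) (k + 1) : ℝ))
    = -(7 / 2) * zetaVal 3 + 6 * Real.log 2 * zetaVal 2 := by
  have h := (hasSum_iff_tendsto_nat_of_nonneg (fun k => by
    have := aa_pos (k + 1); positivity) _).2 partial_tendsto
  rw [FF_val] at h
  rw [zeta_two_val]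
  have e : (fun k : ℕ => (4 : ℝ) ^ (k + 1) /
      ((k + 1 : ℝ) ^ 3 * (Nat.choose (2 * (k + 1)) (k + 1) : ℝ))) =
      fun k : ℕ => aa (k + 1) / ((k : ℝ) + 1) ^ 3 := by
    funext k
    unfold aa
    rw [Nat.centralBinom_eq_two_mul_choose, div_div, mul_comm]
  rw [e, h.tsum_eq]
  ring
end

section
/- ∑_{k=1}^∞ 4^k H_k / (k^2 · C(2k,k)) = (7/2)ζ(3) + 6 ln(2) ζ(2). -/
open Real

open Finset Filter Topology

lemma hcongr {f g : ℕ → ℝ} {a b : ℝ} (h : HasSum f a) (hf : ∀ n, g n = f n) (ha : b = a) :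
    HasSum g b := by
  rw [ha, funext hf]; exact h

lemma swapL {f : ℕ × ℕ → ℝ} (hf : ∀ p, 0 ≤ f p) {g h : ℕ → ℝ} {S : ℝ}
    (hr : ∀ a, HasSum (fun b => f (a, b)) (g a)) (hc : ∀ b, HasSum (fun a => f (a, b)) (h b))
    (hg : HasSum g S) : HasSum h S := by
  have hs : Summable f := by
    refine (summable_prod_of_nonneg hf).2 ⟨fun a => (hr a).summable, ?_⟩
    have : (fun x => ∑' y, f (x, y)) = g := funext fun a => (hr a).tsum_eq
    rw [this]; exact hg.summable
  have h1 : HasSum g (∑' p, f p) := hs.hasSum.prod_fiberwise hr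
  have h2 : ∑' p, f p = S := h1.unique hg
  have h3 : HasSum (f ∘ (Equiv.prodComm ℕ ℕ)) S := by
    rw [Equiv.hasSum_iff, ← h2]; exact hs.hasSum
  exact h3.prod_fiberwise hc

lemma diagL {f : ℕ × ℕ → ℝ} (hf : ∀ p, 0 ≤ f p) {g : ℕ → ℝ} {S : ℝ}
    (hd : HasSum (fun s => ∑ p ∈ antidiagonal s, f p) S)
    (hr : ∀ a, HasSum (fun b => f (a, b)) (g a)) : HasSum g S := by
  have hfib : ∀ s, HasSum (fun p : antidiagonal s => f p) (∑ p ∈ antidiagonal s, f p) := by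
    intro s
    rw [← Finset.sum_coe_sort]
    exact hasSum_fintype _
  have hs' : Summable (f ∘ (Finset.HasAntidiagonal.sigmaAntidiagonalEquivProd (A := ℕ))) := by
    refine (summable_sigma_of_nonneg (fun _ => hf _)).2 ⟨fun s => (hfib s).summable, ?_⟩
    have : (fun s => ∑' p : antidiagonal s, f p) = fun s => ∑ p ∈ antidiagonal s, f p :=
      funext fun s => (hfib s).tsum_eq
    refine Summable.congr hd.summable fun s => ?_
    exact (congrFun this s).symm
  have hs : Summable f := (Equiv.summable_iff _).1 hs'
  have h2 : HasSum (f ∘ (Finset.HasAntidiagonal.sigmaAntidiagonalEquivProd (A := ℕ))) (∑' p, f p) :=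
    (Equiv.hasSum_iff _).2 hs.hasSum
  have h3 := h2.sigma (g := fun s => ∑ p ∈ antidiagonal s, f p) (fun s => hfib s)
  have h4 : ∑' p, f p = S := h3.unique hd
  rw [← h4]
  exact hs.hasSum.prod_fiberwise hr

lemma teleL {a : ℕ → ℝ} (ha : ∀ n, a (n+1) ≤ a n) (h0 : Tendsto a atTop (𝓝 0)) :
    HasSum (fun n => a n - a (n+1)) (a 0) := by
  rw [hasSum_iff_tendsto_nat_of_nonneg (fun n => sub_nonneg.2 (ha n))]
  simp_rw [Finset.sum_range_sub']
  simpa using tendsto_const_nhds.sub h0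

lemma inv_lin_tendsto (b : ℝ) : Tendsto (fun n : ℕ => 1 / (2 * (n:ℝ) + b)) atTop (𝓝 0) := by
  simp_rw [one_div]
  refine tendsto_inv_atTop_zero.comp ?_
  exact tendsto_atTop_add_const_right _ _
    (tendsto_natCast_atTop_atTop.const_mul_atTop (by norm_num : (0:ℝ) < 2))

lemma tele_lin (b : ℝ) (hb : 0 < b) :
    HasSum (fun t : ℕ => 1 / (2 * (t:ℝ) + b) - 1 / (2 * (t:ℝ) + b + 2)) (1 / b) := by
  have := teleL (a := fun n : ℕ => 1 / (2 * (n:ℝ) + b)) (fun n => by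
    push_cast
    apply one_div_le_one_div_of_le <;> [positivity; linarith]) (inv_lin_tendsto b)
  simp only [CharP.cast_eq_zero, mul_zero, zero_add] at this
  refine hcongr (this) (fun t => ?_) (by ring)
  push_cast; ring

noncomputable def OO (k : ℕ) : ℝ := ∑ n ∈ range k, 1 / (2 * (n:ℝ) + 1)
noncomputable def HH (k : ℕ) : ℝ := ∑ n ∈ range k, 1 / ((n:ℝ) + 1)

lemma OO_succ (k : ℕ) : OO (k+1) = OO k + 1 / (2 * (k:ℝ) + 1) := by
  simp [OO, sum_range_succ]
lemma HH_succ (k : ℕ) : HH (k+1) = HH k + 1 / ((k:ℝ) + 1) := by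
  simp [HH, sum_range_succ]

lemma HH_eq (k : ℕ) : HH k = (harmonic k : ℝ) := by
  simp [HH, harmonic]

lemma log2_sum : HasSum (fun n : ℕ => 1 / (2 * (n:ℝ) + 1) - 1 / (2 * (n:ℝ) + 2)) (log 2) := by
  rw [hasSum_iff_tendsto_nat_of_nonneg]
  · have key : ∀ N : ℕ, ∑ n ∈ range N, (1 / (2 * (n:ℝ) + 1) - 1 / (2 * (n:ℝ) + 2))
        = HH (2 * N) - HH N := by
      intro N
      induction N with
      | zero => simp [HH]
      | succ N ih =>
        rw [sum_range_succ, ih, show 2 * (N+1) = 2*N+1+1 by ring, HH_succ, HH_succ, HH_succ]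
        push_cast
        have : (N:ℝ) + 1 ≠ 0 := by positivity
        have : 2 * (N:ℝ) + 1 ≠ 0 := by positivity
        have : 2 * (N:ℝ) + 2 ≠ 0 := by positivity
        have : 2 * (N:ℝ) + 1 + 1 ≠ 0 := by positivity
        field_simp
        ring
    have h1 := Real.tendsto_harmonic_sub_log
    have h2 : Tendsto (fun N : ℕ => 2 * N) atTop atTop :=
      tendsto_id.const_mul_atTop' (by norm_num)
    have h3 := ((h1.comp h2).sub h1).add_const (log 2)
    simp only [sub_self, zero_add] at h3
    refine h3.congr' ?_
    filter_upwards [eventually_gt_atTop 0] with N hN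
    rw [key, HH_eq, HH_eq]
    have : (N:ℝ) ≠ 0 := by positivity
    simp only [Function.comp]
    push_cast
    rw [Real.log_mul (by norm_num) this]
    ring
  · intro n
    rw [sub_nonneg]
    apply one_div_le_one_div_of_le <;> [positivity; linarith]

lemma sumI (n : ℕ) : HasSum (fun t : ℕ => 1 / (2 * (t:ℝ) + 2) - 1 / (2 * (t:ℝ) + 2 * n + 3))
    (OO (n+1) - log 2) := by
  induction n with
  | zero =>
    have := (tele_lin 1 one_pos).sub log2_sum
    refine hcongr (this) (fun t => ?_) ?_
    · push_cast; ring
    · simp [OO]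
  | succ n ih =>
    have := ih.add (tele_lin (2 * n + 3) (by positivity))
    refine hcongr (this) (fun t => ?_) ?_
    · push_cast; ring
    · rw [OO_succ (n+1)]; push_cast; ring

lemma sumII (m : ℕ) : HasSum (fun n : ℕ => 1 / (2 * (n:ℝ) + 1) - 1 / (2 * (n:ℝ) + 2 * m + 2))
    (log 2 + HH m / 2) := by
  induction m with
  | zero =>
    refine hcongr (log2_sum) (fun t => ?_) ?_
    · push_cast; ring
    · simp [HH]
  | succ n ih =>
    have := ih.add (tele_lin (2 * n + 2) (by positivity))
    refine hcongr (this) (fun t => ?_) ?_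
    · push_cast; ring
    · rw [HH_succ n]
      have : (n:ℝ) + 1 ≠ 0 := by positivity
      have : 2 * (n:ℝ) + 2 ≠ 0 := by positivity
      field_simp
      ring

lemma sumIII (t : ℕ) : HasSum (fun n : ℕ => 1 / (2 * (n:ℝ) + 1) - 1 / (2 * (n:ℝ) + 2 * t + 1))
    (OO t) := by
  induction t with
  | zero => simp [OO, hasSum_zero]
  | succ n ih =>
    have := ih.add (tele_lin (2 * n + 1) (by positivity))
    refine hcongr (this) (fun t => ?_) ?_
    · push_cast; ring
    · rw [OO_succ n]

lemma OO_nonneg (k : ℕ) : 0 ≤ OO k := Finset.sum_nonneg fun _ _ => by positivity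
lemma HH_nonneg (k : ℕ) : 0 ≤ HH k := Finset.sum_nonneg fun _ _ => by positivity

lemma HH_le (k : ℕ) : HH k / 2 ≤ OO k := by
  rw [HH, OO, Finset.sum_div]
  refine Finset.sum_le_sum fun i _ => ?_
  rw [div_div]
  apply one_div_le_one_div_of_le <;> [positivity; linarith]

lemma OO_le (k : ℕ) : OO k ≤ √k := by
  induction k with
  | zero => simp [OO]
  | succ k ih =>
    rw [OO_succ]
    have h1 : √(k:ℝ) ≤ k := by
      rcases Nat.eq_zero_or_pos k with h | h
      · simp [h]
      · have : (1:ℝ) ≤ k := by exact_mod_cast h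
        rw [Real.sqrt_le_left (by positivity)]; nlinarith
    have h2 : √((k:ℝ)+1) ≤ k + 1 := by
      rw [Real.sqrt_le_left (by positivity)]; nlinarith [(Nat.cast_nonneg k : (0:ℝ) ≤ k)]
    have h3 : 0 < √((k:ℝ)+1) := Real.sqrt_pos.2 (by positivity)
    have h4 : 0 ≤ √(k:ℝ) := Real.sqrt_nonneg _
    have h5 : √((k:ℝ)+1) - √(k:ℝ) = 1 / (√((k:ℝ)+1) + √(k:ℝ)) := by
      rw [eq_div_iff (by positivity)]
      nlinarith [Real.sq_sqrt (show (0:ℝ) ≤ k by positivity), Real.sq_sqrt (show (0:ℝ) ≤ k + 1 by positivity)]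
    have h6 : 1 / (2 * (k:ℝ) + 1) ≤ 1 / (√((k:ℝ)+1) + √(k:ℝ)) := by
      apply one_div_le_one_div_of_le <;> [positivity; linarith]
    push_cast
    linarith

lemma summ_E : Summable (fun s : ℕ => OO (s+1) / (2 * (s:ℝ) + 1)^2) := by
  have h0 : Summable (fun s : ℕ => 1 / ((s + 1 : ℕ) : ℝ) ^ (3/2 : ℝ)) :=
    (summable_nat_add_iff (f := fun s : ℕ => 1 / (s : ℝ) ^ (3/2 : ℝ)) 1).2
      (Real.summable_one_div_nat_rpow.2 (by norm_num))
  refine Summable.of_nonneg_of_le (fun s => div_nonneg (OO_nonneg _) (by positivity)) (fun s => ?_) h0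
  have hp : (0:ℝ) < ((s + 1 : ℕ) : ℝ) := by positivity
  have h1 : ((s + 1 : ℕ) : ℝ) ^ (3/2 : ℝ) * √((s + 1 : ℕ) : ℝ) = ((s + 1 : ℕ) : ℝ)^2 := by
    rw [Real.sqrt_eq_rpow, ← Real.rpow_add hp, ← Real.rpow_natCast]; norm_num
  have h2 : 0 < ((s + 1 : ℕ) : ℝ) ^ (3/2 : ℝ) := by positivity
  rw [div_le_div_iff₀ (by positivity) h2]
  have h3 := OO_le (s+1)
  have h4 : ((s + 1 : ℕ) : ℝ)^2 ≤ (2 * (s:ℝ) + 1)^2 := by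
    push_cast
    have : (0:ℝ) ≤ s := by positivity
    nlinarith
  nlinarith

lemma summ_R : Summable (fun s : ℕ => OO s / (2 * (s:ℝ) + 1)^2) := by
  refine Summable.of_nonneg_of_le (fun s => div_nonneg (OO_nonneg _) (by positivity)) (fun s => ?_) summ_E
  gcongr
  rw [OO_succ]
  have : 0 ≤ 1 / (2 * (s:ℝ) + 1) := by positivity
  linarith

lemma summ_Q : Summable (fun s : ℕ => HH s / 2 / (2 * (s:ℝ) + 1)^2) := by
  refine Summable.of_nonneg_of_le (fun s => div_nonneg (by linarith [HH_nonneg s]) (by positivity))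
    (fun s => ?_) summ_R
  gcongr
  exact HH_le s

lemma lam (p : ℕ) (hp : 2 ≤ p) :
    HasSum (fun n : ℕ => 1 / (2 * (n:ℝ) + 1) ^ p) ((1 - 1 / 2 ^ p) * zetaVal p) := by
  have hz : Summable (fun n : ℕ => 1 / ((n:ℝ) + 1) ^ p) := by
    have := (summable_nat_add_iff (f := fun s : ℕ => 1 / (s : ℝ) ^ p) 1).2
      (Real.summable_one_div_nat_pow.2 (by omega))
    simpa using this
  have hZ : HasSum (fun n : ℕ => 1 / ((n:ℝ) + 1) ^ p) (zetaVal p) := hz.hasSum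
  have he : Summable (fun n : ℕ => 1 / (2 * (n:ℝ) + 1) ^ p) := by
    have := hz.comp_injective (i := fun n => 2 * n) (mul_right_injective₀ two_ne_zero)
    simpa [Function.comp_def] using this
  have ho : HasSum (fun n : ℕ => 1 / (((2 * n + 1 : ℕ):ℝ) + 1) ^ p) (1 / 2 ^ p * zetaVal p) := by
    refine hcongr (hZ.mul_left (1 / 2 ^ p)) (fun n => ?_) (by ring)
    push_cast
    rw [show (2 * (n:ℝ) + 1 + 1) = 2 * (n + 1) by ring, mul_pow]
    field_simp
  have h1 := HasSum.even_add_odd (f := fun n : ℕ => 1 / ((n:ℝ) + 1) ^ p)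
    (m := ∑' n : ℕ, 1 / (2 * (n:ℝ) + 1) ^ p) (by simpa using he.hasSum) ho
  have h2 := h1.unique hZ
  have h3 := he.hasSum
  convert h3 using 1
  linarith

/-- The Euler sum. -/
lemma euler_sum : HasSum (fun s : ℕ => OO (s+1) / (2 * (s:ℝ) + 1)^2)
    (7 / 16 * zetaVal 3 + 3 / 4 * log 2 * zetaVal 2) := by
  obtain ⟨R, hR⟩ := summ_R
  obtain ⟨Q, hQ⟩ := summ_Q
  have l2 := lam 2 le_rfl
  have l3 := lam 3 (by norm_num)
  set L2 := (1 - 1 / 2 ^ 2) * zetaVal 2 with hL2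
  set L3 := (1 - 1 / 2 ^ 3) * zetaVal 3 with hL3
  have hE : HasSum (fun s : ℕ => OO (s+1) / (2 * (s:ℝ) + 1)^2) (R + L3) := by
    refine hcongr (hR.add l3) (fun s => ?_) (by ring)
    rw [OO_succ]
    have : 2 * (s:ℝ) + 1 ≠ 0 := by positivity
    field_simp
  -- the first array
  let y : ℕ × ℕ → ℝ := fun p => 1 / ((2 * (p.2:ℝ) + 2) * (2 * p.1 + 1) * (2 * p.1 + 2 * p.2 + 3))
  have hy : ∀ p, 0 ≤ y p := fun p => by positivity
  have hyd : HasSum (fun s => ∑ p ∈ antidiagonal s, y p) (R + Q) := by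
    have h1 := hR.add hQ
    rw [← hasSum_nat_add_iff' 1] at h1
    have h00 : R + Q - ∑ i ∈ range 1, (OO i / (2 * (i:ℝ) + 1) ^ 2 + HH i / 2 / (2 * (i:ℝ) + 1) ^ 2)
        = R + Q := by simp [OO, HH]
    rw [h00] at h1
    refine hcongr (h1) (fun s => ?_) (by ring)
    have h2 : ∀ p ∈ antidiagonal s, y p = 1 / (2 * (s:ℝ) + 3) ^ 2 * (1 / (2 * (p.1:ℝ) + 1))
        + 1 / (2 * (s:ℝ) + 3) ^ 2 * (1 / ((p.2:ℝ) + 1) / 2) := by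
      intro p hp
      have : (s:ℝ) = p.1 + p.2 := by rw [← mem_antidiagonal.1 hp]; push_cast; rfl
      rw [this]
      simp only [y]
      have : 2 * (p.1:ℝ) + 2 * p.2 + 3 ≠ 0 := by positivity
      have : 2 * ((p.1:ℝ) + p.2) + 3 ≠ 0 := by positivity
      field_simp
      ring
    rw [Finset.sum_congr rfl h2, Finset.sum_add_distrib, ← Finset.mul_sum, ← Finset.mul_sum,
      ← Finset.sum_div,
      Finset.Nat.sum_antidiagonal_eq_sum_range_succ (fun i j => 1 / (2 * (i:ℝ) + 1)),
      ← Finset.Nat.sum_antidiagonal_swap]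
    simp only [Prod.snd_swap]
    rw [Finset.Nat.sum_antidiagonal_eq_sum_range_succ (fun i j => 1 / ((i:ℝ) + 1))]
    simp only [OO, HH]
    push_cast
    ring
  have hyr : ∀ n, HasSum (fun t => y (n, t)) ((OO (n+1) - log 2) / (2 * (n:ℝ) + 1) ^ 2) := by
    intro n
    refine hcongr ((sumI n).div_const ((2 * (n:ℝ) + 1) ^ 2)) (fun t => ?_) (by ring)
    simp only [y]
    have : 2 * (t:ℝ) + 2 * n + 3 ≠ 0 := by positivity
    have : 2 * (n:ℝ) + 2 * t + 3 ≠ 0 := by positivity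
    field_simp
    ring
  have hyc : ∀ t, HasSum (fun n => y (n, t)) (OO (t+1) / (2 * (t:ℝ) + 2) ^ 2) := by
    intro t
    refine hcongr ((sumIII (t+1)).div_const ((2 * (t:ℝ) + 2) ^ 2)) (fun n => ?_) (by ring)
    simp only [y]
    push_cast
    have : 2 * (n:ℝ) + 2 * (t + 1) + 1 ≠ 0 := by positivity
    have : 2 * (n:ℝ) + 2 * t + 3 ≠ 0 := by positivity
    field_simp
    ring
  have hy1 := diagL hy hyd hyr
  have hy2 := swapL hy hyr hyc hy1
  have r1 : R + Q = R + L3 - log 2 * L2 := by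
    refine hy1.unique ?_
    refine hcongr (hE.sub (l2.mul_left (log 2))) (fun n => ?_) (by ring)
    ring
  let x : ℕ × ℕ → ℝ := fun p => 1 / ((2 * (p.1:ℝ) + 1) * (2 * p.2 + 1) * (2 * p.1 + 2 * p.2 + 2))
  have hx : ∀ p, 0 ≤ x p := fun p => by positivity
  have hxd : HasSum (fun s => ∑ p ∈ antidiagonal s, x p) (2 * (R + Q)) := by
    refine hcongr (hy2.mul_left 2) (fun s => ?_) (by ring)
    have h2 : ∀ p ∈ antidiagonal s, x p = 1 / (2 * (s:ℝ) + 2) ^ 2 * (1 / (2 * (p.1:ℝ) + 1))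
        + 1 / (2 * (s:ℝ) + 2) ^ 2 * (1 / (2 * (p.2:ℝ) + 1)) := by
      intro p hp
      have : (s:ℝ) = p.1 + p.2 := by rw [← mem_antidiagonal.1 hp]; push_cast; rfl
      rw [this]
      simp only [x]
      have : 2 * (p.1:ℝ) + 2 * p.2 + 2 ≠ 0 := by positivity
      have : 2 * ((p.1:ℝ) + p.2) + 2 ≠ 0 := by positivity
      field_simp
      ring
    have h3 : ∑ p ∈ antidiagonal s, 1 / (2 * (p.2:ℝ) + 1) = ∑ p ∈ antidiagonal s, 1 / (2 * (p.1:ℝ) + 1) := by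
      rw [← Finset.Nat.sum_antidiagonal_swap]
      simp only [Prod.snd_swap]
    rw [Finset.sum_congr rfl h2, Finset.sum_add_distrib, ← Finset.mul_sum, ← Finset.mul_sum, h3,
      Finset.Nat.sum_antidiagonal_eq_sum_range_succ (fun i j => 1 / (2 * (i:ℝ) + 1))]
    simp only [OO]
    ring
  have hxr : ∀ m, HasSum (fun n => x (m, n)) ((log 2 + HH m / 2) / (2 * (m:ℝ) + 1) ^ 2) := by
    intro m
    refine hcongr ((sumII m).div_const ((2 * (m:ℝ) + 1) ^ 2)) (fun n => ?_) (by ring)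
    simp only [x]
    have : 2 * (m:ℝ) + 2 * n + 2 ≠ 0 := by positivity
    have : 2 * (n:ℝ) + 2 * m + 2 ≠ 0 := by positivity
    field_simp
    ring
  have hx1 := diagL hx hxd hxr
  have r2 : 2 * (R + Q) = log 2 * L2 + Q := by
    refine hx1.unique ?_
    refine hcongr ((l2.mul_left (log 2)).add hQ) (fun n => ?_) (by ring)
    ring
  convert hE using 1
  rw [hL2] at r1 r2
  rw [hL3] at r1 ⊢
  norm_num at r1 r2 ⊢
  linarith

lemma diagL' {f : ℕ × ℕ → ℝ} (hf : ∀ p, 0 ≤ f p) {g : ℕ → ℝ} {S : ℝ}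
    (hr : ∀ a, HasSum (fun b => f (a, b)) (g a)) (hg : HasSum g S) :
    HasSum (fun s => ∑ p ∈ antidiagonal s, f p) S := by
  have hs : Summable f := by
    refine (summable_prod_of_nonneg hf).2 ⟨fun a => (hr a).summable, ?_⟩
    have : (fun x => ∑' y, f (x, y)) = g := funext fun a => (hr a).tsum_eq
    rw [this]; exact hg.summable
  have h1 : HasSum g (∑' p, f p) := hs.hasSum.prod_fiberwise hr
  rw [← h1.unique hg]
  have h2 : HasSum (f ∘ (Finset.HasAntidiagonal.sigmaAntidiagonalEquivProd (A := ℕ))) (∑' p, f p) :=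
    (Equiv.hasSum_iff _).2 hs.hasSum
  refine h2.sigma (fun s => ?_)
  rw [← Finset.sum_coe_sort]
  exact hasSum_fintype _

noncomputable def WW (c : ℝ) (k : ℕ) : ℝ := ∏ i ∈ range k, ((i:ℝ) + 1) / (c + i)

lemma WW_succ (c : ℝ) (k : ℕ) : WW c (k+1) = WW c k * (((k:ℝ) + 1) / (c + k)) := by
  rw [WW, prod_range_succ]; rfl

lemma WW_zero (c : ℝ) : WW c 0 = 1 := by simp [WW]

lemma WW_pos (c : ℝ) (hc : 0 < c) (k : ℕ) : 0 < WW c k :=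
  Finset.prod_pos fun _ _ => by positivity

lemma WW_shift (c : ℝ) (hc : 0 < c) (k : ℕ) : WW c (k+1) = ((k:ℝ) + 1) / c * WW (c+1) k := by
  induction k with
  | zero => simp [WW]
  | succ k ih =>
    rw [WW_succ, ih, WW_succ]
    push_cast
    have : c + 1 + (k:ℝ) ≠ 0 := by positivity
    have : c + ((k:ℝ) + 1) ≠ 0 := by positivity
    field_simp
    ring

lemma WW_diff (c : ℝ) (hc : 0 < c) (j : ℕ) :
    (WW c (j+1) - WW (c+1) (j+1)) / ((j:ℝ)+1)^2 = 1 / c^2 * (WW (c+1) j - WW (c+1) (j+1)) := by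
  rw [WW_shift c hc, WW_succ]
  have : c + 1 + (j:ℝ) ≠ 0 := by positivity
  field_simp
  ring

lemma WW_anti (c : ℝ) (hc : 1 ≤ c) (k : ℕ) : WW c (k+1) ≤ WW c k := by
  rw [WW_succ]
  apply mul_le_of_le_one_right (WW_pos c (by linarith) k).le
  rw [div_le_one (by positivity)]
  linarith

lemma WW_le_one (c : ℝ) (hc : 1 ≤ c) (k : ℕ) : WW c k ≤ 1 := by
  induction k with
  | zero => simp [WW]
  | succ k ih => exact (WW_anti c hc k).trans ih

lemma WW_sq (c : ℝ) (hc : 1/2 ≤ c) (k : ℕ) : WW (c+1) k ^ 2 ≤ 1 / ((k:ℝ)+1) := by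
  induction k with
  | zero => simp [WW]
  | succ k ih =>
    rw [WW_succ, mul_pow]
    have h1 : (((k:ℝ) + 1) / (c + 1 + k)) ^ 2 ≤ ((k:ℝ)+1) / (k+2) := by
      rw [div_pow, div_le_div_iff₀ (by positivity) (by positivity)]
      have hk : (0:ℝ) ≤ k := by positivity
      have : ((k:ℝ)+1) * (k+2) ≤ (c + 1 + k)^2 := by nlinarith
      nlinarith
    calc _ ≤ 1 / ((k:ℝ)+1) * (((k:ℝ)+1) / (k+2)) := by gcongr
      _ = _ := by
        push_cast
        field_simp
        ring

lemma WW_tendsto (c : ℝ) (hc : 1/2 ≤ c) : Tendsto (WW (c+1)) atTop (𝓝 0) := by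
  have h1 : Tendsto (fun k => WW (c+1) k ^ 2) atTop (𝓝 0) :=
    squeeze_zero (fun k => by positivity) (WW_sq c hc) tendsto_one_div_add_atTop_nhds_zero_nat
  have h2 := h1.sqrt
  rw [Real.sqrt_zero] at h2
  refine h2.congr fun k => ?_
  exact Real.sqrt_sq (WW_pos _ (by linarith) k).le

lemma WW_tendsto_c (c : ℝ) (hc : 0 < c) (j : ℕ) :
    Tendsto (fun n : ℕ => WW (c + n) (j+1)) atTop (𝓝 0) := by
  have h : Tendsto (fun n : ℕ => ((j:ℝ)+1) / (c + n)) atTop (𝓝 0) :=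
    Tendsto.div_atTop tendsto_const_nhds
      (tendsto_atTop_add_const_left _ _ tendsto_natCast_atTop_atTop)
  refine squeeze_zero (fun n => (WW_pos _ (by positivity) _).le) (fun n => ?_) h
  rw [WW_shift _ (by positivity)]
  apply mul_le_of_le_one_right (by positivity)
  apply WW_le_one
  have : (0:ℝ) ≤ n := by positivity
  linarith

lemma WW_anti_c (c : ℝ) (hc : 0 < c) (j : ℕ) : WW (c+1) (j+1) ≤ WW c (j+1) := by
  have h := WW_diff c hc j
  have h1 := WW_anti (c+1) (by linarith) j
  have h2 : 0 ≤ 1 / c^2 * (WW (c+1) j - WW (c+1) (j+1)) :=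
    mul_nonneg (by positivity) (by linarith)
  rw [← h, div_nonneg_iff] at h2
  have : (0:ℝ) < ((j:ℝ)+1)^2 := by positivity
  rcases h2 with h2 | h2
  · linarith [h2.1]
  · linarith [h2.2]

lemma WW_tele_c (c : ℝ) (hc : 0 < c) (j : ℕ) :
    HasSum (fun n : ℕ => WW (c + n) (j+1) - WW (c + n + 1) (j+1)) (WW c (j+1)) := by
  have := teleL (a := fun n : ℕ => WW (c + n) (j+1)) (fun n => by
    have := WW_anti_c (c + n) (by positivity) j
    push_cast
    rw [← add_assoc]; exact this) (WW_tendsto_c c hc j)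
  refine hcongr this (fun n => ?_) (by simp)
  push_cast
  rw [← add_assoc]

lemma WW_tele (c : ℝ) (hc : 1/2 ≤ c) (a : ℕ) :
    HasSum (fun b : ℕ => WW (c+1) (a + b) - WW (c+1) (a + b + 1)) (WW (c+1) a) := by
  have := teleL (a := fun n : ℕ => WW (c + 1) (a + n)) (fun n => WW_anti _ (by linarith) _)
    ((WW_tendsto c hc).comp (tendsto_add_atTop_nat a |>.congr fun n => by ring))
  exact this

/-- Sums with `1/k^2`. -/
lemma T_sum (c : ℝ) (hc : 1/2 ≤ c) (Z : ℝ) (hZ : HasSum (fun m : ℕ => 1 / (c + m)^2) Z) :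
    HasSum (fun j : ℕ => WW c (j+1) / ((j:ℝ)+1)^2) Z := by
  have hc0 : 0 < c := by linarith
  refine swapL (f := fun p => (WW (c + p.1) (p.2+1) - WW (c + p.1 + 1) (p.2+1)) / ((p.2:ℝ)+1)^2)
    (fun p => ?_) (fun a => ?_) (fun b => ?_) hZ
  · have := WW_anti_c (c + p.1) (by positivity) p.2
    exact div_nonneg (by linarith) (by positivity)
  · have ha : 1/2 ≤ c + (a:ℝ) := by
      have : (0:ℝ) ≤ a := by positivity
      linarith
    have := (WW_tele (c + a) ha 0).mul_left (1 / (c + a)^2)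
    refine hcongr this (fun j => ?_) (by simp [WW_zero])
    simp only [zero_add]
    exact WW_diff _ (by positivity) j
  · exact (WW_tele_c c hc0 b).div_const _

lemma parts (c : ℝ) (hc : 1/2 ≤ c) (Z : ℝ) (hZ : HasSum (fun m : ℕ => 1 / (c + m)^2) Z) :
    HasSum (fun j : ℕ => HH (j+1) * (WW (c+1) j - WW (c+1) (j+1))) (c * Z) := by
  have hc0 : 0 < c := by linarith
  have h := (T_sum c hc Z hZ).mul_left c
  refine hcongr (diagL'
    (f := fun p => (WW (c+1) (p.1 + p.2) - WW (c+1) (p.1 + p.2 + 1)) / ((p.1:ℝ)+1))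
    (g := fun a => WW (c+1) a / ((a:ℝ)+1)) (fun p => ?_)
    (fun a => (WW_tele c hc a).div_const _) (hcongr h (fun a => ?_) rfl)) (fun s => ?_) rfl
  · have := WW_anti (c+1) (by linarith) (p.1 + p.2)
    exact div_nonneg (by linarith) (by positivity)
  · rw [WW_shift c hc0]
    field_simp
  · have h2 : ∀ p ∈ antidiagonal s,
        (WW (c+1) (p.1 + p.2) - WW (c+1) (p.1 + p.2 + 1)) / ((p.1:ℝ)+1)
        = 1 / ((p.1:ℝ)+1) * (WW (c+1) s - WW (c+1) (s + 1)) := by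
      intro p hp
      rw [mem_antidiagonal.1 hp]; ring
    rw [Finset.sum_congr rfl h2, ← Finset.sum_mul,
      Finset.Nat.sum_antidiagonal_eq_sum_range_succ (fun i j => 1 / ((i:ℝ) + 1))]
    rfl

lemma zsum (n : ℕ) : Summable (fun m : ℕ => 1 / ((1/2 + n : ℝ) + m)^2) := by
  have h := (lam 2 le_rfl).summable.mul_left 4
  have h2 := (summable_nat_add_iff n).2 h
  refine h2.congr fun m => ?_
  push_cast
  have : 2 * ((m:ℝ) + n) + 1 ≠ 0 := by positivity
  have : (1/2 + n : ℝ) + m ≠ 0 := by positivity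
  field_simp
  ring

lemma final_sum : HasSum (fun j : ℕ => HH (j+1) * WW (1/2) (j+1) / ((j:ℝ)+1)^2)
    (8 * (7 / 16 * zetaVal 3 + 3 / 4 * log 2 * zetaVal 2)) := by
  have hd := euler_sum.mul_left 8
  have hg : HasSum (fun n : ℕ => 1 / (1/2 + n : ℝ) * ∑' m : ℕ, 1 / ((1/2 + n : ℝ) + m)^2)
      (8 * (7 / 16 * zetaVal 3 + 3 / 4 * log 2 * zetaVal 2)) := by
    refine diagL (f := fun p => 1 / (1/2 + p.1 : ℝ) * (1 / ((1/2 + p.1 : ℝ) + p.2)^2))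
      (fun p => by positivity) (hcongr hd (fun s => ?_) rfl)
      (fun a => (zsum a).hasSum.mul_left _)
    have h2 : ∀ p ∈ antidiagonal s, 1 / (1/2 + p.1 : ℝ) * (1 / ((1/2 + p.1 : ℝ) + p.2)^2)
        = 1 / (2 * (p.1:ℝ) + 1) * (8 / (2 * (s:ℝ) + 1)^2) := by
      intro p hp
      have : (s:ℝ) = p.1 + p.2 := by rw [← mem_antidiagonal.1 hp]; push_cast; rfl
      rw [this]
      have e1 : (1/2 + p.1 : ℝ) = (2 * (p.1:ℝ) + 1) / 2 := by ring
      have e2 : ((2 * (p.1:ℝ) + 1) / 2 + p.2) = (2 * ((p.1:ℝ) + p.2) + 1) / 2 := by ring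
      rw [e1, e2]
      have : 2 * ((p.1:ℝ) + p.2) + 1 ≠ 0 := by positivity
      field_simp
      norm_num
    rw [Finset.sum_congr rfl h2, ← Finset.sum_mul,
      Finset.Nat.sum_antidiagonal_eq_sum_range_succ (fun i j => 1 / (2 * (i:ℝ) + 1))]
    simp only [OO]
    ring
  refine swapL (f := fun p => HH (p.2+1) *
      ((WW (1/2 + p.1) (p.2+1) - WW (1/2 + p.1 + 1) (p.2+1)) / ((p.2:ℝ)+1)^2))
    (fun p => ?_) (fun a => ?_) (fun b => ?_) hg
  · have := WW_anti_c (1/2 + p.1) (by positivity) p.2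
    exact mul_nonneg (HH_nonneg _) (div_nonneg (by linarith) (by positivity))
  · have ha : (1:ℝ)/2 ≤ 1/2 + (a:ℝ) := by
      have : (0:ℝ) ≤ a := by positivity
      linarith
    have h := (parts (1/2 + a) ha _ (zsum a).hasSum).mul_left (1 / (1/2 + (a:ℝ))^2)
    refine hcongr h (fun j => ?_) ?_
    · simp only []
      rw [WW_diff _ (by positivity)]
      ring
    · have : (1/2 + (a:ℝ)) ≠ 0 := by positivity
      generalize (∑' m : ℕ, 1 / ((1/2 + a : ℝ) + m)^2) = z
      field_simp
  · have h := ((WW_tele_c (1/2) (by norm_num) b).div_const (((b:ℝ)+1)^2)).mul_left (HH (b+1))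
    refine hcongr h (fun j => rfl) (by ring)

lemma WW_half (k : ℕ) : WW (1/2) k * (Nat.centralBinom k : ℝ) = 4 ^ k := by
  induction k with
  | zero => simp [WW]
  | succ k ih =>
    have h : ((k:ℝ) + 1) * (Nat.centralBinom (k+1) : ℝ) = 2 * (2 * k + 1) * Nat.centralBinom k := by
      exact_mod_cast Nat.succ_mul_centralBinom_succ k
    rw [WW_succ, pow_succ, ← ih]
    have e : (1/2 + (k:ℝ)) = (2 * k + 1) / 2 := by ring
    rw [e]
    have : 2 * (k:ℝ) + 1 ≠ 0 := by positivity
    calc _ = WW (1/2) k * (2 / (2 * k + 1)) * (((k:ℝ) + 1) * (Nat.centralBinom (k+1) : ℝ)) := by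
          field_simp
      _ = _ := by
          rw [h]; field_simp; ring

theorem stmt_17 :
    ∑' k : ℕ, (4 : ℝ) ^ (k + 1) * genHarmonic (k + 1) 1 /
      ((k + 1 : ℝ) ^ 2 * (Nat.choose (2 * (k + 1)) (k + 1) : ℝ))
    = 7 / 2 * zetaVal 3 + 6 * Real.log 2 * zetaVal 2 := by
  refine HasSum.tsum_eq (hcongr final_sum (fun k => ?_) (by ring))
  have h := WW_half (k+1)
  rw [Nat.centralBinom] at h
  have hp : (0:ℝ) < (Nat.choose (2 * (k + 1)) (k + 1) : ℝ) := by
    exact_mod_cast Nat.centralBinom_pos (k+1)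
  have hH : genHarmonic (k+1) 1 = HH (k+1) := by simp [genHarmonic, HH]
  rw [← h, hH]
  field_simp
end

section
/- ∫_0^{π/2} x^3 ln(sin(x)) dx = −(93/128)ζ(5) + (27/32)ζ(2)ζ(3) − (45/32) ln(2) ζ(4). -/
open Real

theorem aux_tsum_nat (m : ℕ) (hm : 2 ≤ m) :
    HasSum (fun n : ℕ => 1 / (n : ℝ) ^ m) (zetaVal m) := by
  have hs : Summable (fun n : ℕ => 1 / (n : ℝ) ^ m) :=
    Real.summable_one_div_nat_pow.mpr (by omega)
  have h := hs.hasSum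
  rw [hs.tsum_eq_zero_add] at h
  have h0 : (0 : ℝ) ^ m = 0 := zero_pow (by omega)
  simpa [zetaVal, h0] using h

theorem aux_eta (m : ℕ) (hm : 2 ≤ m) :
    HasSum (fun n : ℕ => (-1 : ℝ) ^ n / (n : ℝ) ^ m) ((2 / 2 ^ m - 1) * zetaVal m) := by
  have h := aux_tsum_nat m hm
  have hinj : Function.Injective (fun n : ℕ => 2 * n) := fun a b h => by
    simpa using h
  have h2 : HasSum (fun n : ℕ => (-1 : ℝ) ^ n / (n : ℝ) ^ m + 1 / (n : ℝ) ^ m)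
      (2 / 2 ^ m * zetaVal m) := by
    rw [← hinj.hasSum_iff]
    · have e : ((fun n : ℕ => (-1 : ℝ) ^ n / (n : ℝ) ^ m + 1 / (n : ℝ) ^ m) ∘ fun n => 2 * n)
          = fun n : ℕ => 2 / 2 ^ m * (1 / (n : ℝ) ^ m) := by
        funext n
        simp only [Function.comp, pow_mul, Nat.cast_mul, mul_pow]
        norm_num
        ring
      rw [e]
      exact h.mul_left (2 / 2 ^ m)
    · intro n hn
      have : Odd n := by
        rw [← Nat.not_even_iff_odd]
        rintro ⟨k, hk⟩
        exact hn ⟨k, by simp; omega⟩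
      rw [this.neg_one_pow]; ring
  have h3 := h2.sub h
  have e : 2 / 2 ^ m * zetaVal m - zetaVal m = (2 / 2 ^ m - 1) * zetaVal m := by ring
  rw [e] at h3
  have e2 : (fun n : ℕ => (-1 : ℝ) ^ n / (n : ℝ) ^ m + 1 / (n : ℝ) ^ m - 1 / (n : ℝ) ^ m)
      = (fun n : ℕ => (-1 : ℝ) ^ n / (n : ℝ) ^ m) := by
    funext n
    ring
  rw [e2] at h3
  exact h3

theorem aux_int (n : ℕ) :
    ∫ x in (0 : ℝ)..(π / 2), x ^ 3 * (Real.cos (2 * n * x) / n)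
      = 3 * π ^ 2 / 16 * ((-1) ^ n / (n : ℝ) ^ 3) -
        3 / 8 * ((-1) ^ n / (n : ℝ) ^ 5 - 1 / (n : ℝ) ^ 5) := by
  rcases Nat.eq_zero_or_pos n with rfl | hn
  · simp
  have hn0 : (n : ℝ) ≠ 0 := by positivity
  have hd : ∀ x : ℝ, HasDerivAt (fun x : ℝ => x ^ 3 * Real.sin (2 * n * x) / (2 * n ^ 2)
      + 3 * x ^ 2 * Real.cos (2 * n * x) / (4 * n ^ 3)
      - 6 * x * Real.sin (2 * n * x) / (8 * n ^ 4)
      - 6 * Real.cos (2 * n * x) / (16 * n ^ 5)) (x ^ 3 * (Real.cos (2 * n * x) / n)) x := by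
    intro x
    have hl : HasDerivAt (fun x : ℝ => 2 * (n : ℝ) * x) (2 * n) x := by
      simpa using (hasDerivAt_id x).const_mul (2 * (n : ℝ))
    have hs := hl.sin
    have hc := hl.cos
    have h1 := ((hasDerivAt_pow 3 x).mul hs).div_const (2 * (n : ℝ) ^ 2)
    have h2 := (((hasDerivAt_pow 2 x).const_mul 3).mul hc).div_const (4 * (n : ℝ) ^ 3)
    have h3 := (((hasDerivAt_id x).const_mul 6).mul hs).div_const (8 * (n : ℝ) ^ 4)
    have h4 := (hc.const_mul 6).div_const (16 * (n : ℝ) ^ 5)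
    refine (((h1.add h2).sub h3).sub h4).congr_deriv ?_
    simp only [id]
    field_simp
    push_cast
    ring
  rw [intervalIntegral.integral_eq_sub_of_hasDerivAt (fun x _ => hd x)
    (Continuous.intervalIntegrable (by fun_prop) _ _)]
  have e : 2 * (n : ℝ) * (π / 2) = n * π := by ring
  rw [e, Real.sin_nat_mul_pi, Real.cos_nat_mul_pi]
  simp
  field_simp
  ring

theorem aux_log (r x : ℝ) (h0 : 0 < r) (h1 : r < 1) :
    HasSum (fun n : ℕ => r ^ n * (Real.cos (2 * n * x) / n))
      (-(Real.log (1 - 2 * r * Real.cos (2 * x) + r ^ 2) / 2)) := by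
  set z : ℂ := r * Complex.exp ((2 * x : ℝ) * Complex.I) with hz
  have hn : ‖z‖ < 1 := by
    rw [hz, norm_mul, Complex.norm_exp_ofReal_mul_I, Complex.norm_real, Real.norm_eq_abs,
      abs_of_pos h0, mul_one]
    exact h1
  have h := Complex.hasSum_re (Complex.hasSum_taylorSeries_neg_log hn)
  convert h using 1
  · ext n
    rw [hz, mul_pow, ← Complex.exp_nat_mul]
    have e : (n : ℂ) * ((2 * x : ℝ) * Complex.I) = ((2 * n * x : ℝ) : ℂ) * Complex.I := by
      push_cast; ring
    rw [e, Complex.div_natCast_re, ← Complex.ofReal_pow, Complex.re_ofReal_mul,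
      Complex.exp_ofReal_mul_I_re]
    ring
  · rw [Complex.neg_re, Complex.log_re]
    have e : 1 - 2 * r * Real.cos (2 * x) + r ^ 2 = ‖1 - z‖ ^ 2 := by
      rw [← Complex.normSq_eq_norm_sq, Complex.normSq_apply]
      simp only [Complex.sub_re, Complex.sub_im, hz, Complex.re_ofReal_mul,
        Complex.im_ofReal_mul, Complex.exp_ofReal_mul_I_re, Complex.exp_ofReal_mul_I_im,
        Complex.one_re, Complex.one_im]
      nlinarith [Real.sin_sq_add_cos_sq (2 * x)]
    rw [e, Real.log_pow]
    push_cast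
    ring

theorem aux_termwise (r : ℝ) (h0 : 0 < r) (h1 : r < 1) :
    HasSum (fun n : ℕ => r ^ n * (3 * π ^ 2 / 16 * ((-1) ^ n / (n : ℝ) ^ 3) -
        3 / 8 * ((-1) ^ n / (n : ℝ) ^ 5 - 1 / (n : ℝ) ^ 5)))
      (∫ x in (0 : ℝ)..(π / 2),
        x ^ 3 * (-(Real.log (1 - 2 * r * Real.cos (2 * x) + r ^ 2) / 2))) := by
  have key := intervalIntegral.hasSum_integral_of_dominated_convergence
    (μ := MeasureTheory.volume) (a := 0) (b := π / 2)
    (F := fun (n : ℕ) x => r ^ n * (x ^ 3 * (Real.cos (2 * n * x) / n)))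
    (f := fun x => x ^ 3 * (-(Real.log (1 - 2 * r * Real.cos (2 * x) + r ^ 2) / 2)))
    (bound := fun n x => r ^ n * |x ^ 3|) ?_ ?_ ?_ ?_ ?_
  · have e : (fun n : ℕ => ∫ x in (0 : ℝ)..(π / 2), r ^ n * (x ^ 3 * (Real.cos (2 * n * x) / n)))
        = (fun n : ℕ => r ^ n * (3 * π ^ 2 / 16 * ((-1) ^ n / (n : ℝ) ^ 3) -
        3 / 8 * ((-1) ^ n / (n : ℝ) ^ 5 - 1 / (n : ℝ) ^ 5))) := by
      funext n
      rw [intervalIntegral.integral_const_mul, aux_int]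
    rw [← e]
    exact key
  · intro n
    exact Continuous.aestronglyMeasurable (by fun_prop)
  · intro n
    refine Filter.Eventually.of_forall fun x _ => ?_
    rw [Real.norm_eq_abs, abs_mul, abs_mul, abs_of_pos (pow_pos h0 n)]
    refine mul_le_mul_of_nonneg_left ?_ (pow_pos h0 n).le
    refine mul_le_of_le_one_right (abs_nonneg _) ?_
    rw [abs_div, Nat.abs_cast]
    rcases Nat.eq_zero_or_pos n with rfl | hn
    · simp
    · rw [div_le_one (by positivity)]
      exact (Real.abs_cos_le_one _).trans (by exact_mod_cast hn)
  · exact Filter.Eventually.of_forall fun x _ =>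
      (summable_geometric_of_lt_one h0.le h1).mul_right _
  · simp_rw [tsum_mul_right]
    exact Continuous.intervalIntegrable (by fun_prop) _ _
  · refine Filter.Eventually.of_forall fun x _ => ?_
    have e : (fun n : ℕ => r ^ n * (x ^ 3 * (Real.cos (2 * n * x) / n)))
        = (fun n : ℕ => x ^ 3 * (r ^ n * (Real.cos (2 * n * x) / n))) := by
      funext n
      ring
    have h := (aux_log r x h0 h1).mul_left (x ^ 3)
    rw [← e] at h
    exact h

open Filter Topology in
theorem aux_lim :
    Tendsto (fun r : ℝ => ∫ x in (0 : ℝ)..(π / 2),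
        x ^ 3 * (-(Real.log (1 - 2 * r * Real.cos (2 * x) + r ^ 2) / 2))) (𝓝[<] 1)
      (𝓝 (∫ x in (0 : ℝ)..(π / 2), x ^ 3 * (-(Real.log 2 + Real.log (Real.sin x))))) := by
  have hmem : ∀ᶠ r : ℝ in 𝓝[<] 1, 0 < r ∧ r < 1 := by
    filter_upwards [Ioo_mem_nhdsLT (show (0 : ℝ) < 1 by norm_num)] with r hr using hr
  have hmain : ∀ᵐ x : ℝ ∂MeasureTheory.volume, x ≠ π / 2 := by
    simp [MeasureTheory.ae_iff]
  have hpi := Real.pi_pos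
  refine intervalIntegral.tendsto_integral_filter_of_dominated_convergence
    (fun x => |x ^ 3| * (|Real.log (Real.sin (2 * x))| + Real.log 4)) ?_ ?_ ?_ ?_
  · refine Eventually.of_forall fun r => Measurable.aestronglyMeasurable ?_
    fun_prop
  · filter_upwards [hmem] with r hr
    filter_upwards [hmain] with x hx hxI
    rw [Set.uIoc_of_le (by positivity)] at hxI
    have hx2 : x < π / 2 := lt_of_le_of_ne hxI.2 hx
    have hs : 0 < Real.sin (2 * x) := Real.sin_pos_of_pos_of_lt_pi (by linarith [hxI.1]) (by linarith)
    rw [Real.norm_eq_abs, abs_mul]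
    refine mul_le_mul_of_nonneg_left ?_ (abs_nonneg _)
    have hc := Real.cos_le_one (2 * x)
    have hc' := Real.neg_one_le_cos (2 * x)
    have hlow : Real.sin (2 * x) ^ 2 ≤ 1 - 2 * r * Real.cos (2 * x) + r ^ 2 := by
      nlinarith [Real.sin_sq_add_cos_sq (2 * x), sq_nonneg (r - Real.cos (2 * x))]
    have hup : 1 - 2 * r * Real.cos (2 * x) + r ^ 2 ≤ 4 := by nlinarith
    have hpos := lt_of_lt_of_le (pow_pos hs 2) hlow
    have l1 := Real.log_le_log (pow_pos hs 2) hlow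
    have l2 := Real.log_le_log hpos hup
    rw [Real.log_pow] at l1
    push_cast at l1
    have l3 : 0 ≤ Real.log 4 := Real.log_nonneg (by norm_num)
    have l4 := neg_abs_le (Real.log (Real.sin (2 * x)))
    have l5 := abs_nonneg (Real.log (Real.sin (2 * x)))
    rw [abs_le]
    constructor <;> linarith
  · have i1 : IntervalIntegrable (fun x => Real.log (Real.sin (2 * x))) MeasureTheory.volume 0 (π / 2) := by
      simpa using (intervalIntegrable_log_sin (a := 0) (b := π)).comp_mul_left (c := 2)
    have i2 := i1.abs.add (intervalIntegrable_const (c := Real.log 4))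
    exact i2.continuousOn_mul (g := fun x => |x ^ 3|) (by fun_prop)
  · filter_upwards [hmain] with x hx hxI
    rw [Set.uIoc_of_le (by positivity)] at hxI
    have hs : 0 < Real.sin x := Real.sin_pos_of_pos_of_lt_pi hxI.1 (by linarith [hxI.2])
    have e : Real.log 2 + Real.log (Real.sin x) =
        Real.log (1 - 2 * 1 * Real.cos (2 * x) + 1 ^ 2) / 2 := by
      have : 1 - 2 * 1 * Real.cos (2 * x) + 1 ^ 2 = (2 * Real.sin x) ^ 2 := by
        rw [Real.cos_two_mul]; nlinarith [Real.sin_sq_add_cos_sq x]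
      rw [this, Real.log_pow, Real.log_mul (by norm_num) hs.ne']
      push_cast; ring
    rw [e]
    have hne : 1 - 2 * 1 * Real.cos (2 * x) + 1 ^ 2 ≠ 0 := by
      have : 1 - 2 * 1 * Real.cos (2 * x) + 1 ^ 2 = (2 * Real.sin x) ^ 2 := by
        rw [Real.cos_two_mul]; nlinarith [Real.sin_sq_add_cos_sq x]
      rw [this]; positivity
    have : ContinuousAt (fun r : ℝ =>
        x ^ 3 * (-(Real.log (1 - 2 * r * Real.cos (2 * x) + r ^ 2) / 2))) 1 := by
      refine continuousAt_const.mul (ContinuousAt.neg (ContinuousAt.div_const ?_ _))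
      exact ContinuousAt.log (by fun_prop) hne
    exact this.tendsto.mono_left nhdsWithin_le_nhds

open Filter Topology in
theorem stmt_18 :
    ∫ x in (0 : ℝ)..(π / 2), x ^ 3 * Real.log (Real.sin x)
    = -(93 / 128) * zetaVal 5 + 27 / 32 * zetaVal 2 * zetaVal 3 - 45 / 32 * Real.log 2 * zetaVal 4 := by
  have hA : HasSum (fun n : ℕ => (3 * π ^ 2 / 16 * ((-1) ^ n / (n : ℝ) ^ 3) -
        3 / 8 * ((-1) ^ n / (n : ℝ) ^ 5 - 1 / (n : ℝ) ^ 5))) _ :=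
    ((aux_eta 3 (by norm_num)).mul_left (3 * π ^ 2 / 16)).sub
      (((aux_eta 5 (by norm_num)).sub (aux_tsum_nat 5 (by norm_num))).mul_left (3 / 8))
  have hab := Real.tendsto_tsum_powerSeries_nhdsWithin_lt hA.tendsto_sum_nat
  have hlim := aux_lim
  have hEq : (fun r : ℝ => ∫ x in (0 : ℝ)..(π / 2),
        x ^ 3 * (-(Real.log (1 - 2 * r * Real.cos (2 * x) + r ^ 2) / 2))) =ᶠ[𝓝[<] 1]
      (fun r : ℝ => ∑' n : ℕ, (3 * π ^ 2 / 16 * ((-1) ^ n / (n : ℝ) ^ 3) -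
        3 / 8 * ((-1) ^ n / (n : ℝ) ^ 5 - 1 / (n : ℝ) ^ 5)) * r ^ n) := by
    filter_upwards [Ioo_mem_nhdsLT (show (0 : ℝ) < 1 by norm_num)] with r hr
    rw [← (aux_termwise r hr.1 hr.2).tsum_eq]
    exact tsum_congr fun n => mul_comm _ _
  have hval := tendsto_nhds_unique (hlim.congr' hEq) hab
  have i1 : IntervalIntegrable (fun x : ℝ => x ^ 3 * Real.log (Real.sin x))
      MeasureTheory.volume 0 (π / 2) :=
    (intervalIntegrable_log_sin (a := 0) (b := π / 2)).continuousOn_mul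
      (g := fun x => x ^ 3) (by fun_prop)
  have hsplit : ∫ x in (0 : ℝ)..(π / 2), x ^ 3 * (-(Real.log 2 + Real.log (Real.sin x)))
      = -(Real.log 2 * (π ^ 4 / 64)) - ∫ x in (0 : ℝ)..(π / 2), x ^ 3 * Real.log (Real.sin x) := by
    have : ∀ x : ℝ, x ^ 3 * (-(Real.log 2 + Real.log (Real.sin x)))
      = (-Real.log 2) * x ^ 3 - x ^ 3 * Real.log (Real.sin x) := fun x => by ring
    simp_rw [this]
    rw [intervalIntegral.integral_sub (Continuous.intervalIntegrable (by fun_prop) _ _) i1,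
      intervalIntegral.integral_const_mul, integral_pow]
    push_cast
    ring
  have z2 : zetaVal 2 = π ^ 2 / 6 := (aux_tsum_nat 2 le_rfl).unique hasSum_zeta_two
  have z4 : zetaVal 4 = π ^ 4 / 90 := (aux_tsum_nat 4 (by norm_num)).unique hasSum_zeta_four
  rw [hsplit] at hval
  rw [z2, z4]
  linarith
end
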